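/- arXiv:2407.02915 — 5 statements merged into one kernel-verified Lean document; each statement's English description precedes it below -/
import Mathlib

section
/- For all 0 ≤ s ≤ t ≤ T, the time-changed Brownian motion satisfies E[M_t | F^M_s ∨ F^Λ_T] = M_s almost surely; in particular the increment M_t − M_s has vanishing conditional expectation given F^M_s ∨ F^Λ_T. -/
open MeasureTheory ProbabilityTheory

noncomputable section

/-- The σ-algebra generated by the `P`-null sets. -/
def nullSA {Ω : Type*} [MeasurableSpace Ω] (P : Measure Ω) : MeasurableSpace Ω :=
  MeasurableSpace.generateFrom {s : Set Ω | P s = 0}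

/-- The `P`-augmented natural σ-algebra generated by a real-valued process up to time `r`:
`σ(X_u, 0 ≤ u ≤ r) ∨ N`. -/
def natSA {Ω : Type*} [MeasurableSpace Ω] (P : Measure Ω) (X : ℝ → Ω → ℝ) (r : ℝ) :
    MeasurableSpace Ω :=
  (⨆ u ∈ Set.Icc (0 : ℝ) r, MeasurableSpace.comap (X u) inferInstance) ⊔ nullSA P

/-- A standard Brownian motion on `[0,R]` under `PW`: jointly measurable, starting at `0`,
with continuous paths, increments independent of the past, and Gaussian increments. -/
structure IsBrownian {ΩW : Type*} [MeasurableSpace ΩW] (PW : Measure ΩW) (R : ℝ)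
    (W : ℝ → ΩW → ℝ) : Prop where
  measurable : Measurable (Function.uncurry W)
  start : ∀ ω, W 0 ω = 0
  cont : ∀ ω, ContinuousOn (fun r => W r ω) (Set.Icc 0 R)
  indep_incr : ∀ s t : ℝ, 0 ≤ s → s ≤ t → t ≤ R →
    Indep (MeasurableSpace.comap (fun ω => W t ω - W s ω) inferInstance)
      (⨆ u ∈ Set.Icc (0 : ℝ) s, MeasurableSpace.comap (W u) inferInstance) PW
  gauss_incr : ∀ s t : ℝ, 0 ≤ s → s ≤ t → t ≤ R →
    PW.map (fun ω => W t ω - W s ω) = gaussianReal 0 (Real.toNNReal (t - s))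

/-- A time change on `[0,T]`: measurable, nondecreasing, right-continuous, starting at `0`,
with values in `[0,R]`. -/
structure IsTimeChange {ΩΛ : Type*} [MeasurableSpace ΩΛ] (T R : ℝ) (Lam : ℝ → ΩΛ → ℝ) :
    Prop where
  measurable : ∀ t, Measurable (Lam t)
  mono : ∀ ω, MonotoneOn (fun t => Lam t ω) (Set.Icc 0 T)
  right_cont : ∀ ω, ∀ t ∈ Set.Ico 0 T, ContinuousWithinAt (fun s => Lam s ω) (Set.Ici t) t
  start : ∀ ω, Lam 0 ω = 0
  mem : ∀ ω, ∀ t ∈ Set.Icc 0 T, Lam t ω ∈ Set.Icc 0 R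

variable {ΩΛ ΩW : Type*} [mΛ : MeasurableSpace ΩΛ] [mW : MeasurableSpace ΩW]

/-- The Brownian motion lifted to the product space: `W_r(ω_Λ, ω_W) = W_r(ω_W)`. -/
def liftW (W : ℝ → ΩW → ℝ) (r : ℝ) : ΩΛ × ΩW → ℝ := fun ω => W r ω.2

/-- The time change lifted to the product space: `Λ_t(ω_Λ, ω_W) = Λ_t(ω_Λ)`. -/
def liftLam (Lam : ℝ → ΩΛ → ℝ) (t : ℝ) : ΩΛ × ΩW → ℝ := fun ω => Lam t ω.1

/-- The time-changed Brownian motion `M_t = W_{Λ_t}`. -/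
def tcBM (W : ℝ → ΩW → ℝ) (Lam : ℝ → ΩΛ → ℝ) (t : ℝ) : ΩΛ × ΩW → ℝ :=
  fun ω => W (Lam t ω.1) ω.2

/-- The filtration `F`: `F_t = ⋂_{s > t} (F^M_s ∨ F^Λ_s)` for `t < T`, and
`F_T = F^M_T ∨ F^Λ_T`. -/
def Ffilt (P : Measure (ΩΛ × ΩW)) (W : ℝ → ΩW → ℝ) (Lam : ℝ → ΩΛ → ℝ) (T t : ℝ) :
    MeasurableSpace (ΩΛ × ΩW) :=
  if t < T then ⨅ s ∈ Set.Ioc t T, (natSA P (tcBM W Lam) s ⊔ natSA P (liftLam Lam) s)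
  else natSA P (tcBM W Lam) T ⊔ natSA P (liftLam Lam) T

/-- The initially enlarged filtration `H_r = F^W_r ∨ F^Λ_T`. -/
def Hfilt (P : Measure (ΩΛ × ΩW)) (W : ℝ → ΩW → ℝ) (Lam : ℝ → ΩΛ → ℝ) (T r : ℝ) :
    MeasurableSpace (ΩΛ × ΩW) :=
  natSA P (liftW W) r ⊔ natSA P (liftLam Lam) T

/-- The time-changed enlarged filtration
`Ĥ_t = H_{Λ_t} = {A ∈ H_R : A ∩ {Λ_t ≤ r} ∈ H_r for all r ∈ [0,R]}`. -/
def HhatSA (P : Measure (ΩΛ × ΩW)) (W : ℝ → ΩW → ℝ) (Lam : ℝ → ΩΛ → ℝ) (T R t : ℝ) :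
    MeasurableSpace (ΩΛ × ΩW) :=
  MeasurableSpace.generateFrom
    {A | MeasurableSet[Hfilt P W Lam T R] A ∧
      ∀ r ∈ Set.Icc (0 : ℝ) R, MeasurableSet[Hfilt P W Lam T r] (A ∩ {ω | Lam t ω.1 ≤ r})}

/-- The generalised inverse (first-hitting-time process) of the time change:
`Γ_r = inf {t ∈ [0,T] : Λ_t > r}` for `r < Λ_T`, and `Γ_r = T` otherwise. -/
def genInvP (T : ℝ) {ΩΛ : Type*} (Lam : ℝ → ΩΛ → ℝ) (r : ℝ) (ωΛ : ΩΛ) : ℝ :=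
  if r < Lam T ωΛ then sInf {t ∈ Set.Icc 0 T | r < Lam t ωΛ} else T

lemma aux_integral (PW : Measure ΩW) [IsProbabilityMeasure PW] (R : ℝ) (W : ℝ → ΩW → ℝ)
    (hW : IsBrownian PW R W) (r : ℝ) (h0 : 0 ≤ r) (hr : r ≤ R) :
    Integrable (W r) PW ∧ ∫ ω, ‖W r ω‖ ∂PW ≤ 1 + R := by
  have hm : Measurable (W r) := hW.measurable.of_uncurry_left
  have hmap : PW.map (W r) = gaussianReal 0 (Real.toNNReal r) := by
    have := hW.gauss_incr 0 r le_rfl h0 hr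
    simpa [hW.start] using this
  have h2 : MemLp (fun x : ℝ => x) 2 (PW.map (W r)) := by
    rw [hmap]; exact memLp_id_gaussianReal 2
  have hL2 : MemLp (W r) 2 PW := (memLp_map_measure_iff (by fun_prop) hm.aemeasurable).1 h2
  have hI : Integrable (W r) PW := hL2.integrable (by norm_num)
  refine ⟨hI, ?_⟩
  have hsq : ∫ ω, (W r ω) ^ 2 ∂PW = r := by
    have e1 : ∫ ω, (W r ω) ^ 2 ∂PW = ∫ x, x ^ 2 ∂(PW.map (W r)) :=
      (integral_map (f := fun x : ℝ => x ^ 2) hm.aemeasurable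
        (by fun_prop : Measurable fun x : ℝ => x ^ 2).aestronglyMeasurable).symm
    rw [e1, hmap]
    have := variance_id_gaussianReal (μ := 0) (v := Real.toNNReal r)
    rw [variance_eq_integral (by fun_prop)] at this
    simpa [h0] using this
  calc ∫ ω, ‖W r ω‖ ∂PW ≤ ∫ ω, (1 + (W r ω) ^ 2) ∂PW := by
        refine integral_mono hI.norm ((integrable_const _).add hL2.integrable_sq) ?_
        intro ω
        simp only [Real.norm_eq_abs]
        nlinarith [sq_abs (W r ω), sq_nonneg (|W r ω| - 1), abs_nonneg (W r ω)]
    _ = 1 + r := by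
        rw [integral_add (integrable_const _) hL2.integrable_sq, hsq]; simp
    _ ≤ 1 + R := by linarith

lemma aux_tc_meas (PW : Measure ΩW) (T R : ℝ) (W : ℝ → ΩW → ℝ) (Lam : ℝ → ΩΛ → ℝ)
    (hW : IsBrownian PW R W) (hLam : IsTimeChange T R Lam) (t : ℝ) :
    Measurable (tcBM W Lam t) :=
  hW.measurable.comp (((hLam.measurable t).comp measurable_fst).prodMk measurable_snd)

lemma aux_tc_int (PΛ : Measure ΩΛ) (PW : Measure ΩW)
    [IsProbabilityMeasure PΛ] [IsProbabilityMeasure PW]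
    (T R : ℝ) (W : ℝ → ΩW → ℝ) (Lam : ℝ → ΩΛ → ℝ)
    (hW : IsBrownian PW R W) (hLam : IsTimeChange T R Lam) (t : ℝ) (ht : t ∈ Set.Icc 0 T) :
    Integrable (tcBM W Lam t) (PΛ.prod PW) := by
  have hm := (aux_tc_meas PW T R W Lam hW hLam t)
  have hs : AEStronglyMeasurable (tcBM W Lam t) (PΛ.prod PW) := hm.aestronglyMeasurable
  rw [integrable_prod_iff hs]
  have hb := fun ω => aux_integral PW R W hW (Lam t ω) (hLam.mem ω t ht).1 (hLam.mem ω t ht).2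
  refine ⟨Filter.Eventually.of_forall fun ω => (hb ω).1, ?_⟩
  refine Integrable.mono' (integrable_const (1 + R)) hs.norm.integral_prod_right' ?_
  refine Filter.Eventually.of_forall fun ω => ?_
  rw [Real.norm_of_nonneg (integral_nonneg fun _ => norm_nonneg _)]
  exact (hb ω).2

lemma aux_incr (PW : Measure ΩW) [IsProbabilityMeasure PW] (R : ℝ) (W : ℝ → ΩW → ℝ)
    (hW : IsBrownian PW R W) (r q : ℝ) (h0 : 0 ≤ r) (hrq : r ≤ q) (hq : q ≤ R) (B : Set ΩW)
    (hB : MeasurableSet[⨆ u ∈ Set.Icc (0 : ℝ) r, MeasurableSpace.comap (W u) inferInstance] B) :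
    ∫ ω in B, (W q ω - W r ω) ∂PW = 0 := by
  have hm : ∀ u, Measurable (W u) := fun u => hW.measurable.of_uncurry_left
  have hle : (⨆ u ∈ Set.Icc (0 : ℝ) r, MeasurableSpace.comap (W u) inferInstance) ≤ mW :=
    iSup₂_le fun u _ => (hm u).comap_le
  have hd : Measurable (fun ω => W q ω - W r ω) := (hm q).sub (hm r)
  have hint : Integrable (fun ω => W q ω - W r ω) PW :=
    (aux_integral PW R W hW q (h0.trans hrq) hq).1.sub (aux_integral PW R W hW r h0 (hrq.trans hq)).1
  have hz : ∫ ω, (W q ω - W r ω) ∂PW = 0 := by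
    have e1 : ∫ ω, (W q ω - W r ω) ∂PW = ∫ x, x ∂(PW.map (fun ω => W q ω - W r ω)) :=
      (integral_map (f := fun x : ℝ => x) hd.aemeasurable
        measurable_id.aestronglyMeasurable).symm
    rw [e1, hW.gauss_incr r q h0 hrq hq, integral_id_gaussianReal]
  have hc := condExp_indep_eq (μ := PW) hd.comap_le hle
    (comap_measurable (fun ω => W q ω - W r ω)).stronglyMeasurable (hW.indep_incr r q h0 hrq hq)
  rw [← setIntegral_condExp hle hint hB, setIntegral_congr_ae (hle _ hB) (hc.mono fun _ h _ => h), hz]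
  simp

lemma aux_main (PΛ : Measure ΩΛ) (PW : Measure ΩW)
    [IsProbabilityMeasure PΛ] [IsProbabilityMeasure PW]
    (T R : ℝ) (W : ℝ → ΩW → ℝ) (Lam : ℝ → ΩΛ → ℝ)
    (hW : IsBrownian PW R W) (hLam : IsTimeChange T R Lam) (s t : ℝ) (hs : 0 ≤ s) (hst : s ≤ t)
    (ht : t ≤ T) (B : Set (ΩΛ × ΩW))
    (hB : MeasurableSet[(⨆ u ∈ Set.Icc (0 : ℝ) s,
      MeasurableSpace.comap (tcBM W Lam u) inferInstance) ⊔
        MeasurableSpace.comap (Prod.fst : ΩΛ × ΩW → ΩΛ) mΛ] B) :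
    ∫ ω in B, (tcBM W Lam t ω - tcBM W Lam s ω) ∂(PΛ.prod PW) = 0 := by
  have hsT : s ∈ Set.Icc 0 T := ⟨hs, hst.trans ht⟩
  have htT : t ∈ Set.Icc 0 T := ⟨hs.trans hst, ht⟩
  have hint : Integrable (fun ω => tcBM W Lam t ω - tcBM W Lam s ω) (PΛ.prod PW) :=
    (aux_tc_int PΛ PW T R W Lam hW hLam t htT).sub (aux_tc_int PΛ PW T R W Lam hW hLam s hsT)
  have hB' : MeasurableSet B := by
    refine (sup_le (iSup₂_le fun u _ => ?_) ?_ : _ ≤ (Prod.instMeasurableSpace)) _ hB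
    · exact (aux_tc_meas PW T R W Lam hW hLam u).comap_le
    · exact measurable_fst.comap_le
  rw [← integral_indicator hB', integral_prod _ (hint.indicator hB')]
  refine integral_eq_zero_of_ae (Filter.Eventually.of_forall fun x => ?_)
  have hsec : MeasurableSet[⨆ u ∈ Set.Icc (0 : ℝ) (Lam s x),
      MeasurableSpace.comap (W u) inferInstance] (Prod.mk x ⁻¹' B) := by
    have hmeas : (⨆ u ∈ Set.Icc (0 : ℝ) s,
      MeasurableSpace.comap (tcBM W Lam u) inferInstance) ⊔
        MeasurableSpace.comap (Prod.fst : ΩΛ × ΩW → ΩΛ) mΛ ≤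
        MeasurableSpace.map (Prod.mk x) (⨆ u ∈ Set.Icc (0 : ℝ) (Lam s x),
      MeasurableSpace.comap (W u) inferInstance) := by
      refine sup_le (iSup₂_le fun u hu => ?_) ?_
      · rintro _ ⟨C, hC, rfl⟩
        have huT : u ∈ Set.Icc 0 T := ⟨hu.1, hu.2.trans hsT.2⟩
        have hmem : Lam u x ∈ Set.Icc (0 : ℝ) (Lam s x) :=
          ⟨(hLam.mem x u huT).1, hLam.mono x huT hsT hu.2⟩
        exact (le_iSup₂_of_le (f := fun u (_ : u ∈ Set.Icc (0 : ℝ) (Lam s x)) =>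
          MeasurableSpace.comap (W u) inferInstance) (Lam u x) hmem le_rfl) _ ⟨C, hC, rfl⟩
      · rintro _ ⟨C, hC, rfl⟩
        rw [MeasurableSpace.map_def]
        exact @MeasurableSet.const _ (_) (x ∈ C)
    exact hmeas _ hB
  have key := aux_incr PW R W hW (Lam s x) (Lam t x) (hLam.mem x s hsT).1
    (hLam.mono x hsT htT hst) (hLam.mem x t htT).2 _ hsec
  rw [← integral_indicator (measurable_prodMk_left hB')] at key
  exact key

/-- For all `0 ≤ s ≤ t ≤ T`, `E[M_t | F^M_s ∨ F^Λ_T] = M_s` a.s.: `M_s` is measurable w.r.t. `F^M_s ∨ F^Λ_T` and the set integrals of `M_t` and `M_s` agree on this σ-algebra; in particular the increment `M_t − M_s` has vanishing conditional expectation. -/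
theorem timeChanged_BM_condExp_initial_enlargement
    (T R : ℝ) (hT : 0 < T) (hR : 0 < R)
    (PΛ : Measure ΩΛ) (PW : Measure ΩW)
    [IsProbabilityMeasure PΛ] [IsProbabilityMeasure PW]
    (hcΛ : PΛ.IsComplete) (hcW : PW.IsComplete)
    (W : ℝ → ΩW → ℝ) (Lam : ℝ → ΩΛ → ℝ)
    (hW : IsBrownian PW R W) (hLam : IsTimeChange T R Lam)
    (P : Measure (ΩΛ × ΩW)) (hP : P = PΛ.prod PW)
    (hFLamT : natSA P (liftLam Lam) T
      = MeasurableSpace.comap (Prod.fst : ΩΛ × ΩW → ΩΛ) mΛ ⊔ nullSA P)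
    (hFWR : natSA P (liftW W) R
      = MeasurableSpace.comap (Prod.snd : ΩΛ × ΩW → ΩW) mW ⊔ nullSA P) :
    ∀ s t : ℝ, 0 ≤ s → s ≤ t → t ≤ T →
      Measurable[natSA P (tcBM W Lam) s ⊔ natSA P (liftLam Lam) T] (tcBM W Lam s) ∧
      (∀ A : Set (ΩΛ × ΩW),
        MeasurableSet[natSA P (tcBM W Lam) s ⊔ natSA P (liftLam Lam) T] A →
          ∫ ω in A, tcBM W Lam t ω ∂P = ∫ ω in A, tcBM W Lam s ω ∂P) ∧
      (∀ A : Set (ΩΛ × ΩW),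
        MeasurableSet[natSA P (tcBM W Lam) s ⊔ natSA P (liftLam Lam) T] A →
          ∫ ω in A, (tcBM W Lam t ω - tcBM W Lam s ω) ∂P = 0) := by
  subst hP
  intro s t hs hst ht
  have hsT : s ∈ Set.Icc 0 T := ⟨hs, hst.trans ht⟩
  have htT : t ∈ Set.Icc 0 T := ⟨hs.trans hst, ht⟩
  have h3 : ∀ A : Set (ΩΛ × ΩW),
        MeasurableSet[natSA (PΛ.prod PW) (tcBM W Lam) s ⊔ natSA (PΛ.prod PW) (liftLam Lam) T] A →
          ∫ ω in A, (tcBM W Lam t ω - tcBM W Lam s ω) ∂(PΛ.prod PW) = 0 := by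
    intro A hA
    rw [hFLamT] at hA
    have hle : natSA (PΛ.prod PW) (tcBM W Lam) s ⊔
        (MeasurableSpace.comap (Prod.fst : ΩΛ × ΩW → ΩΛ) mΛ ⊔ nullSA (PΛ.prod PW)) ≤
        eventuallyMeasurableSpace ((⨆ u ∈ Set.Icc (0 : ℝ) s,
      MeasurableSpace.comap (tcBM W Lam u) inferInstance) ⊔
        MeasurableSpace.comap (Prod.fst : ΩΛ × ΩW → ΩΛ) mΛ) (ae (PΛ.prod PW)) := by
      have hn : nullSA (PΛ.prod PW) ≤ eventuallyMeasurableSpace ((⨆ u ∈ Set.Icc (0 : ℝ) s,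
          MeasurableSpace.comap (tcBM W Lam u) inferInstance) ⊔
          MeasurableSpace.comap (Prod.fst : ΩΛ × ΩW → ΩΛ) mΛ) (ae (PΛ.prod PW)) :=
        MeasurableSpace.generateFrom_le fun N hN =>
          ⟨∅, @MeasurableSet.empty _ (_), ae_eq_empty.2 hN⟩
      refine sup_le (sup_le ?_ hn) (sup_le ?_ hn)
      · exact le_sup_left.trans le_eventuallyMeasurableSpace
      · exact le_sup_right.trans le_eventuallyMeasurableSpace
    obtain ⟨B, hB, hAB⟩ := hle _ hA
    rw [setIntegral_congr_set hAB]
    exact aux_main PΛ PW T R W Lam hW hLam s t hs hst ht B hB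
  refine ⟨?_, ?_, h3⟩
  · rw [measurable_iff_comap_le]
    refine le_trans ?_ (le_sup_left.trans le_sup_left)
    exact le_iSup₂_of_le (f := fun u (_ : u ∈ Set.Icc (0 : ℝ) s) =>
          MeasurableSpace.comap (tcBM W Lam u) inferInstance) s ⟨hs, le_rfl⟩ le_rfl
  · intro A hA
    have := h3 A hA
    rw [integral_sub (aux_tc_int PΛ PW T R W Lam hW hLam t htT).integrableOn
      (aux_tc_int PΛ PW T R W Lam hW hLam s hsT).integrableOn] at this
    linarith

end
end

section
/- The time-changed Brownian motion M = (W_{Λ_t})_{t ∈ [0,T]} is an F-martingale: M is F-adapted, each M_t is integrable, and E[M_t | F_s] = M_s almost surely for all 0 ≤ s ≤ t ≤ T. -/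
open MeasureTheory ProbabilityTheory

noncomputable section

variable {ΩΛ ΩW : Type*} [mΛ : MeasurableSpace ΩΛ] [mW : MeasurableSpace ΩW]

lemma bm_incr_memLp {PW : Measure ΩW} {R : ℝ} {W : ℝ → ΩW → ℝ} (hW : IsBrownian PW R W)
    {a b : ℝ} (ha : 0 ≤ a) (hab : a ≤ b) (hb : b ≤ R) :
    MemLp (fun ω => W b ω - W a ω) 2 PW := by
  have hmb : ∀ r, Measurable (W r) := fun r => hW.measurable.comp measurable_prodMk_left
  have hm : AEMeasurable (fun ω => W b ω - W a ω) PW := ((hmb b).sub (hmb a)).aemeasurable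
  have h := memLp_id_gaussianReal' (μ := 0) (v := Real.toNNReal (b - a)) 2 (by simp)
  rw [← hW.gauss_incr a b ha hab hb] at h
  exact h.comp_of_map hm

lemma bm_incr_mean {PW : Measure ΩW} {R : ℝ} {W : ℝ → ΩW → ℝ} (hW : IsBrownian PW R W)
    {a b : ℝ} (ha : 0 ≤ a) (hab : a ≤ b) (hb : b ≤ R) :
    ∫ ω, (W b ω - W a ω) ∂PW = 0 := by
  have hmb : ∀ r, Measurable (W r) := fun r => hW.measurable.comp measurable_prodMk_left
  have hm : AEMeasurable (fun ω => W b ω - W a ω) PW := ((hmb b).sub (hmb a)).aemeasurable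
  have h := integral_id_gaussianReal (μ := 0) (v := Real.toNNReal (b - a))
  rw [← hW.gauss_incr a b ha hab hb, integral_map hm (by fun_prop)] at h
  exact h

lemma bm_incr_abs {PW : Measure ΩW} [IsProbabilityMeasure PW] {R : ℝ} {W : ℝ → ΩW → ℝ}
    (hW : IsBrownian PW R W)
    {a b : ℝ} (ha : 0 ≤ a) (hab : a ≤ b) (hb : b ≤ R) :
    ∫ ω, |W b ω - W a ω| ∂PW ≤ Real.sqrt (b - a) := by
  have hmb : ∀ r, Measurable (W r) := fun r => hW.measurable.comp measurable_prodMk_left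
  have hm : AEMeasurable (fun ω => W b ω - W a ω) PW := ((hmb b).sub (hmb a)).aemeasurable
  have hL := bm_incr_memLp hW ha hab hb
  have hv : Var[fun ω => W b ω - W a ω; PW] = b - a := by
    have h := variance_id_gaussianReal (μ := 0) (v := Real.toNNReal (b - a))
    rw [← hW.gauss_incr a b ha hab hb, variance_map (by fun_prop) hm] at h
    rw [Real.coe_toNNReal _ (by linarith)] at h
    exact h
  rw [variance_eq_sub hL, bm_incr_mean hW ha hab hb] at hv
  have hL' : MemLp (fun ω => |W b ω - W a ω|) 2 PW := hL.abs
  have h0 := variance_nonneg (fun ω => |W b ω - W a ω|) PW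
  rw [variance_eq_sub hL'] at h0
  apply Real.le_sqrt_of_sq_le
  have e : (fun ω => |W b ω - W a ω|) ^ 2 = (fun ω => W b ω - W a ω) ^ 2 := by
    ext ω; simp
  rw [e] at h0
  linarith

lemma bm_incr_setInt {PW : Measure ΩW} [IsProbabilityMeasure PW] {R : ℝ} {W : ℝ → ΩW → ℝ}
    (hW : IsBrownian PW R W)
    {a b : ℝ} (ha : 0 ≤ a) (hab : a ≤ b) (hb : b ≤ R) {B : Set ΩW}
    (hB : MeasurableSet[⨆ u ∈ Set.Icc (0 : ℝ) a, MeasurableSpace.comap (W u) inferInstance] B) :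
    ∫ ω in B, (W b ω - W a ω) ∂PW = 0 := by
  have hmb : ∀ r, Measurable (W r) := fun r => hW.measurable.comp measurable_prodMk_left
  have hle1 : MeasurableSpace.comap (fun ω => W b ω - W a ω) inferInstance ≤ mW :=
    ((hmb b).sub (hmb a)).comap_le
  have hle2 : (⨆ u ∈ Set.Icc (0 : ℝ) a, MeasurableSpace.comap (W u) inferInstance) ≤ mW :=
    iSup₂_le fun u _ => (hmb u).comap_le
  have hi : Integrable (fun ω => W b ω - W a ω) PW :=
    (bm_incr_memLp hW ha hab hb).integrable (by norm_num)
  have h := condExp_indep_eq hle1 hle2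
    (f := fun ω => W b ω - W a ω)
    (Measurable.stronglyMeasurable (comap_measurable (fun ω => W b ω - W a ω)))
    (hW.indep_incr a b ha hab hb)
  rw [← setIntegral_condExp hle2 hi hB, setIntegral_congr_ae₀ (g := fun _ => 0)]
  · simp
  · exact (hle2 _ hB).nullMeasurableSet
  · filter_upwards [h] with ω hω _
    rw [hω, bm_incr_mean hW ha hab hb]

lemma tcBM_measurable {T R : ℝ} {PW : Measure ΩW} {W : ℝ → ΩW → ℝ} {Lam : ℝ → ΩΛ → ℝ}
    (hW : IsBrownian PW R W) (hLam : IsTimeChange T R Lam) (t : ℝ) :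
    Measurable (tcBM W Lam t) :=
  hW.measurable.comp (((hLam.measurable t).comp measurable_fst).prodMk measurable_snd)

lemma sqrt_incr_integrable {T R : ℝ} {PΛ : Measure ΩΛ} [IsProbabilityMeasure PΛ]
    {Lam : ℝ → ΩΛ → ℝ} (hLam : IsTimeChange T R Lam)
    {s t : ℝ} (hs : 0 ≤ s) (hst : s ≤ t) (ht : t ≤ T) :
    Integrable (fun ω => Real.sqrt (Lam t ω - Lam s ω)) PΛ := by
  refine Integrable.of_bound
    ((hLam.measurable t).sub (hLam.measurable s)).sqrt.aestronglyMeasurable (Real.sqrt R) ?_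
  refine Filter.Eventually.of_forall fun ω => ?_
  have h1 := hLam.mem ω t ⟨hs.trans hst, ht⟩
  have h2 := hLam.mem ω s ⟨hs, hst.trans ht⟩
  rw [Real.norm_of_nonneg (Real.sqrt_nonneg _)]
  exact Real.sqrt_le_sqrt (by linarith [h1.2, h2.1])

lemma tcBM_incr_integrable {T R : ℝ} {PΛ : Measure ΩΛ} {PW : Measure ΩW}
    [IsProbabilityMeasure PΛ] [IsProbabilityMeasure PW]
    {W : ℝ → ΩW → ℝ} {Lam : ℝ → ΩΛ → ℝ}
    (hW : IsBrownian PW R W) (hLam : IsTimeChange T R Lam)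
    {s t : ℝ} (hs : 0 ≤ s) (hst : s ≤ t) (ht : t ≤ T) :
    Integrable (fun ω => tcBM W Lam t ω - tcBM W Lam s ω) (PΛ.prod PW) := by
  have hm : AEStronglyMeasurable (fun ω => tcBM W Lam t ω - tcBM W Lam s ω) (PΛ.prod PW) :=
    ((tcBM_measurable hW hLam t).sub (tcBM_measurable hW hLam s)).aestronglyMeasurable
  have hA : ∀ ω, 0 ≤ Lam s ω ∧ Lam s ω ≤ Lam t ω ∧ Lam t ω ≤ R := fun ω =>
    ⟨(hLam.mem ω s ⟨hs, hst.trans ht⟩).1,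
      hLam.mono ω ⟨hs, hst.trans ht⟩ ⟨hs.trans hst, ht⟩ hst,
      (hLam.mem ω t ⟨hs.trans hst, ht⟩).2⟩
  rw [integrable_prod_iff hm]
  constructor
  · refine Filter.Eventually.of_forall fun ω => ?_
    obtain ⟨h1, h2, h3⟩ := hA ω
    exact (bm_incr_memLp hW h1 h2 h3).integrable (by norm_num)
  · refine (sqrt_incr_integrable (PΛ := PΛ) hLam hs hst ht).mono hm.norm.integral_prod_right' ?_
    refine Filter.Eventually.of_forall fun ω => ?_
    obtain ⟨h1, h2, h3⟩ := hA ω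
    rw [Real.norm_of_nonneg (integral_nonneg fun _ => norm_nonneg _),
      Real.norm_of_nonneg (Real.sqrt_nonneg _)]
    exact bm_incr_abs hW h1 h2 h3

lemma tcBM_incr_abs {T R : ℝ} {PΛ : Measure ΩΛ} {PW : Measure ΩW}
    [IsProbabilityMeasure PΛ] [IsProbabilityMeasure PW]
    {W : ℝ → ΩW → ℝ} {Lam : ℝ → ΩΛ → ℝ}
    (hW : IsBrownian PW R W) (hLam : IsTimeChange T R Lam)
    {s t : ℝ} (hs : 0 ≤ s) (hst : s ≤ t) (ht : t ≤ T) :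
    ∫ ω, |tcBM W Lam t ω - tcBM W Lam s ω| ∂(PΛ.prod PW)
      ≤ ∫ ω, Real.sqrt (Lam t ω - Lam s ω) ∂PΛ := by
  have hi := (tcBM_incr_integrable (PΛ := PΛ) hW hLam hs hst ht).abs
  rw [integral_prod _ hi]
  refine integral_mono hi.integral_prod_left (sqrt_incr_integrable hLam hs hst ht) fun ω => ?_
  exact bm_incr_abs hW (hLam.mem ω s ⟨hs, hst.trans ht⟩).1
    (hLam.mono ω ⟨hs, hst.trans ht⟩ ⟨hs.trans hst, ht⟩ hst)
    (hLam.mem ω t ⟨hs.trans hst, ht⟩).2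

lemma tcBM_integrable {T R : ℝ} {PΛ : Measure ΩΛ} {PW : Measure ΩW}
    [IsProbabilityMeasure PΛ] [IsProbabilityMeasure PW]
    {W : ℝ → ΩW → ℝ} {Lam : ℝ → ΩΛ → ℝ}
    (hW : IsBrownian PW R W) (hLam : IsTimeChange T R Lam)
    {t : ℝ} (h0 : 0 ≤ t) (ht : t ≤ T) :
    Integrable (tcBM W Lam t) (PΛ.prod PW) := by
  have h := tcBM_incr_integrable (PΛ := PΛ) hW hLam le_rfl h0 ht
  simp only [tcBM, hLam.start, hW.start, sub_zero] at h
  exact h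

/-- The unaugmented σ-algebra generated by `M` and `Λ` up to time `u`. -/
def rawSA (W : ℝ → ΩW → ℝ) (Lam : ℝ → ΩΛ → ℝ) (u : ℝ) : MeasurableSpace (ΩΛ × ΩW) :=
  (⨆ v ∈ Set.Icc (0 : ℝ) u, MeasurableSpace.comap (tcBM W Lam v) inferInstance) ⊔
  (⨆ v ∈ Set.Icc (0 : ℝ) u, MeasurableSpace.comap (liftLam Lam v) inferInstance)

lemma rawSA_le {T R : ℝ} {PW : Measure ΩW} {W : ℝ → ΩW → ℝ} {Lam : ℝ → ΩΛ → ℝ}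
    (hW : IsBrownian PW R W) (hLam : IsTimeChange T R Lam) (u : ℝ) :
    rawSA W Lam u ≤ (inferInstance : MeasurableSpace (ΩΛ × ΩW)) :=
  sup_le (iSup₂_le fun v _ => (tcBM_measurable hW hLam v).comap_le)
    (iSup₂_le fun v _ => ((hLam.measurable v).comp measurable_fst).comap_le)

/-- Sections of `σ(M_v, Λ_v, v ≤ u)`-sets belong to the past of `W` up to `Λ_u`. -/
lemma rawSA_section {T R : ℝ} {W : ℝ → ΩW → ℝ} {Lam : ℝ → ΩΛ → ℝ}
    (hLam : IsTimeChange T R Lam) {u : ℝ} (hu : u ≤ T) (ω : ΩΛ) :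
    rawSA W Lam u ≤ MeasurableSpace.map (Prod.mk ω)
      (⨆ r ∈ Set.Icc (0 : ℝ) (Lam u ω), MeasurableSpace.comap (W r) inferInstance) := by
  refine sup_le (iSup₂_le fun v hv => ?_) (iSup₂_le fun v hv => ?_)
  · rw [← MeasurableSpace.comap_le_iff_le_map, MeasurableSpace.comap_comp]
    refine le_iSup₂_of_le (Lam v ω) ⟨?_, ?_⟩ le_rfl
    · exact (hLam.mem ω v ⟨hv.1, hv.2.trans hu⟩).1
    · exact hLam.mono ω ⟨hv.1, hv.2.trans hu⟩ ⟨hv.1.trans hv.2, hu⟩ hv.2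
  · rw [← MeasurableSpace.comap_le_iff_le_map, MeasurableSpace.comap_comp]
    have : (liftLam Lam v ∘ Prod.mk ω : ΩW → ℝ) = fun _ => Lam v ω := rfl
    rw [this, MeasurableSpace.comap_const]
    exact bot_le

lemma aug_ae_eq (P : Measure (ΩΛ × ΩW)) (W : ℝ → ΩW → ℝ) (Lam : ℝ → ΩΛ → ℝ) (u : ℝ)
    {A : Set (ΩΛ × ΩW)}
    (hA : MeasurableSet[natSA P (tcBM W Lam) u ⊔ natSA P (liftLam Lam) u] A) :
    ∃ B, MeasurableSet[rawSA W Lam u] B ∧ A =ᵐ[P] B := by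
  have hN : nullSA P ≤ eventuallyMeasurableSpace (rawSA W Lam u) (ae P) := by
    refine MeasurableSpace.generateFrom_le fun s hs => ?_
    exact ⟨∅, @MeasurableSet.empty _ (rawSA W Lam u), ae_eq_empty.mpr hs⟩
  have hr : rawSA W Lam u ≤ eventuallyMeasurableSpace (rawSA W Lam u) (ae P) :=
    le_eventuallyMeasurableSpace
  have h : natSA P (tcBM W Lam) u ⊔ natSA P (liftLam Lam) u
      ≤ eventuallyMeasurableSpace (rawSA W Lam u) (ae P) :=
    sup_le (sup_le (le_sup_left.trans hr) hN) (sup_le (le_sup_right.trans hr) hN)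
  exact h A hA

lemma tcBM_setInt {T R : ℝ} {PΛ : Measure ΩΛ} {PW : Measure ΩW}
    [IsProbabilityMeasure PΛ] [IsProbabilityMeasure PW]
    {W : ℝ → ΩW → ℝ} {Lam : ℝ → ΩΛ → ℝ}
    (hW : IsBrownian PW R W) (hLam : IsTimeChange T R Lam)
    {s t : ℝ} (hs : 0 ≤ s) (hst : s ≤ t) (ht : t ≤ T) {A : Set (ΩΛ × ΩW)}
    (hA : MeasurableSet[natSA (PΛ.prod PW) (tcBM W Lam) s ⊔
      natSA (PΛ.prod PW) (liftLam Lam) s] A) :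
    ∫ ω in A, (tcBM W Lam t ω - tcBM W Lam s ω) ∂(PΛ.prod PW) = 0 := by
  obtain ⟨B, hB, hAB⟩ := aug_ae_eq _ W Lam s hA
  have hBm : MeasurableSet B := rawSA_le hW hLam s B hB
  have hi := tcBM_incr_integrable (PΛ := PΛ) hW hLam hs hst ht
  rw [setIntegral_congr_set hAB, ← integral_indicator hBm, integral_prod _ (hi.indicator hBm)]
  refine integral_eq_zero_of_ae (Filter.Eventually.of_forall fun ω => ?_)
  have hsec := rawSA_section (W := W) hLam (hst.trans ht) ω B hB
  have h0 := bm_incr_setInt hW (hLam.mem ω s ⟨hs, hst.trans ht⟩).1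
    (hLam.mono ω ⟨hs, hst.trans ht⟩ ⟨hs.trans hst, ht⟩ hst)
    (hLam.mem ω t ⟨hs.trans hst, ht⟩).2 hsec
  rw [← integral_indicator (measurable_prodMk_left hBm)] at h0
  exact h0

/-- The time-changed Brownian motion `M = (W_{Λ_t})` is an `F`-martingale: it is `F`-adapted, each `M_t` is integrable, and `E[M_t | F_s] = M_s` a.s. for all `0 ≤ s ≤ t ≤ T`, expressed via equality of the set integrals over every `F_s`-measurable set. -/
theorem timeChanged_BM_is_F_martingale
    (T R : ℝ) (hT : 0 < T) (hR : 0 < R)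
    (PΛ : Measure ΩΛ) (PW : Measure ΩW)
    [IsProbabilityMeasure PΛ] [IsProbabilityMeasure PW]
    (hcΛ : PΛ.IsComplete) (hcW : PW.IsComplete)
    (W : ℝ → ΩW → ℝ) (Lam : ℝ → ΩΛ → ℝ)
    (hW : IsBrownian PW R W) (hLam : IsTimeChange T R Lam)
    (P : Measure (ΩΛ × ΩW)) (hP : P = PΛ.prod PW)
    (hFLamT : natSA P (liftLam Lam) T
      = MeasurableSpace.comap (Prod.fst : ΩΛ × ΩW → ΩΛ) mΛ ⊔ nullSA P)
    (hFWR : natSA P (liftW W) R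
      = MeasurableSpace.comap (Prod.snd : ΩΛ × ΩW → ΩW) mW ⊔ nullSA P) :
    (∀ t ∈ Set.Icc (0 : ℝ) T, Measurable[Ffilt P W Lam T t] (tcBM W Lam t)) ∧
    (∀ t ∈ Set.Icc (0 : ℝ) T, Integrable (tcBM W Lam t) P) ∧
    ∀ s t : ℝ, 0 ≤ s → s ≤ t → t ≤ T →
      ∀ A : Set (ΩΛ × ΩW), MeasurableSet[Ffilt P W Lam T s] A →
        ∫ ω in A, tcBM W Lam t ω ∂P = ∫ ω in A, tcBM W Lam s ω ∂P := by
  subst hP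
  refine ⟨fun t ht => ?_, fun t ht => tcBM_integrable hW hLam ht.1 ht.2, ?_⟩
  · rw [measurable_iff_comap_le]
    unfold Ffilt
    have key : ∀ s, t ≤ s → MeasurableSpace.comap (tcBM W Lam t) inferInstance ≤
        natSA (PΛ.prod PW) (tcBM W Lam) s ⊔ natSA (PΛ.prod PW) (liftLam Lam) s := fun s hs =>
      (le_iSup₂_of_le (f := fun u (_ : u ∈ Set.Icc (0 : ℝ) s) =>
        MeasurableSpace.comap (tcBM W Lam u) inferInstance) t ⟨ht.1, hs⟩ le_rfl).trans
        (le_sup_left.trans le_sup_left)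
    split_ifs with h
    · exact le_iInf₂ fun s hs => key s hs.1.le
    · exact key T ht.2
  · intro s t hs hst ht A hA
    rcases hst.eq_or_lt with rfl | hlt
    · rfl
    have hsT : s < T := hlt.trans_le ht
    unfold Ffilt at hA
    rw [if_pos hsT] at hA
    have hAu : ∀ u ∈ Set.Ioc s T, MeasurableSet[natSA (PΛ.prod PW) (tcBM W Lam) u ⊔
        natSA (PΛ.prod PW) (liftLam Lam) u] A := fun u hu =>
      (show (⨅ u ∈ Set.Ioc s T, (natSA (PΛ.prod PW) (tcBM W Lam) u ⊔
        natSA (PΛ.prod PW) (liftLam Lam) u)) ≤ _ from iInf₂_le u hu) A hA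
    have hI : ∀ u ∈ Set.Icc 0 T, Integrable (tcBM W Lam u) ((PΛ.prod PW).restrict A) :=
      fun u hu => (tcBM_integrable hW hLam hu.1 hu.2).restrict
    have hbound : ∀ u ∈ Set.Ioo s t,
        |∫ ω in A, tcBM W Lam t ω ∂(PΛ.prod PW) - ∫ ω in A, tcBM W Lam s ω ∂(PΛ.prod PW)|
          ≤ ∫ ω, Real.sqrt (Lam u ω - Lam s ω) ∂PΛ := by
      intro u hu
      have hu0 : 0 ≤ u := hs.trans hu.1.le
      have huT : u ≤ T := hu.2.le.trans ht
      have h1 := tcBM_setInt hW hLam hu0 hu.2.le ht (hAu u ⟨hu.1, huT⟩)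
      rw [integral_sub (hI t ⟨hs.trans hst, ht⟩) (hI u ⟨hu0, huT⟩)] at h1
      have h2 : ∫ ω in A, tcBM W Lam t ω ∂(PΛ.prod PW) - ∫ ω in A, tcBM W Lam s ω ∂(PΛ.prod PW)
          = ∫ ω in A, (tcBM W Lam u ω - tcBM W Lam s ω) ∂(PΛ.prod PW) := by
        rw [integral_sub (hI u ⟨hu0, huT⟩) (hI s ⟨hs, hsT.le⟩)]
        linarith
      rw [h2]
      refine (abs_integral_le_integral_abs).trans (le_trans ?_
        (tcBM_incr_abs (PΛ := PΛ) hW hLam hs hu.1.le huT))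
      exact integral_mono_measure Measure.restrict_le_self
        (Filter.Eventually.of_forall fun _ => abs_nonneg _)
        (tcBM_incr_integrable (PΛ := PΛ) hW hLam hs hu.1.le huT).abs
    have hev : ∀ᶠ u in nhdsWithin s (Set.Ioi s), u ∈ Set.Ioo s t :=
      Ioo_mem_nhdsGT hlt
    have hlim : Filter.Tendsto (fun u => ∫ ω, Real.sqrt (Lam u ω - Lam s ω) ∂PΛ)
        (nhdsWithin s (Set.Ioi s)) (nhds (∫ _, (0 : ℝ) ∂PΛ)) := by
      refine tendsto_integral_filter_of_dominated_convergence (fun _ => Real.sqrt R) ?_ ?_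
        (integrable_const _) ?_
      · exact Filter.Eventually.of_forall fun u =>
          ((hLam.measurable u).sub (hLam.measurable s)).sqrt.aestronglyMeasurable
      · filter_upwards [hev] with u hu
        refine Filter.Eventually.of_forall fun ω => ?_
        have h1 := hLam.mem ω u ⟨hs.trans hu.1.le, hu.2.le.trans ht⟩
        have h2 := hLam.mem ω s ⟨hs, hsT.le⟩
        rw [Real.norm_of_nonneg (Real.sqrt_nonneg _)]
        exact Real.sqrt_le_sqrt (by linarith [h1.2, h2.1])
      · refine Filter.Eventually.of_forall fun ω => ?_
        have h1 : Filter.Tendsto (fun u => Lam u ω) (nhdsWithin s (Set.Ioi s))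
            (nhds (Lam s ω)) :=
          (hLam.right_cont ω s ⟨hs, hsT⟩).mono_left (nhdsWithin_mono _ Set.Ioi_subset_Ici_self)
        have h2 := (Real.continuous_sqrt.tendsto _).comp (h1.sub_const (Lam s ω))
        simpa [Function.comp_def] using h2
    rw [integral_zero] at hlim
    have h0 := ge_of_tendsto hlim (hev.mono hbound)
    exact sub_eq_zero.mp (abs_eq_zero.mp (le_antisymm h0 (abs_nonneg _)))

end
end

section
/- The initially enlarged filtration H_r := F^W_r ∨ F^Λ_T is right-continuous: for every r ∈ [0,R), ⋂_{s > r} H_s = H_r. -/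
open MeasureTheory ProbabilityTheory

noncomputable section

variable {ΩΛ ΩW : Type*} [mΛ : MeasurableSpace ΩΛ] [mW : MeasurableSpace ΩW]

section helpers

/-- The π-system of intersections generating a supremum of two σ-algebras. -/
def interPi {Ω : Type*} (m1 m2 : MeasurableSpace Ω) : Set (Set Ω) :=
  {S | ∃ E F, MeasurableSet[m1] E ∧ MeasurableSet[m2] F ∧ S = E ∩ F}

lemma interPi_isPiSystem {Ω : Type*} (m1 m2 : MeasurableSpace Ω) :
    IsPiSystem (interPi m1 m2) := by
  rintro _ ⟨E, F, hE, hF, rfl⟩ _ ⟨E', F', hE', hF', rfl⟩ _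
  exact ⟨E ∩ E', F ∩ F', MeasurableSet.inter hE hE', MeasurableSet.inter hF hF',
    Set.inter_inter_inter_comm _ _ _ _⟩

lemma sup_eq_generateFrom_interPi {Ω : Type*} (m1 m2 : MeasurableSpace Ω) :
    m1 ⊔ m2 = MeasurableSpace.generateFrom (interPi m1 m2) := by
  apply le_antisymm
  · refine sup_le ?_ ?_
    · intro E hE
      exact MeasurableSpace.measurableSet_generateFrom
        ⟨E, Set.univ, hE, MeasurableSet.univ, by simp⟩
    · intro F hF
      exact MeasurableSpace.measurableSet_generateFrom
        ⟨Set.univ, F, MeasurableSet.univ, hF, by simp⟩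
  · refine MeasurableSpace.generateFrom_le ?_
    rintro _ ⟨E, F, hE, hF, rfl⟩
    exact MeasurableSet.inter ((le_sup_left : m1 ≤ m1 ⊔ m2) E hE)
      ((le_sup_right : m2 ≤ m1 ⊔ m2) F hF)

lemma indep_sup_chain {Ω : Type*} {m0 : MeasurableSpace Ω} {P : Measure Ω}
    [IsProbabilityMeasure P] {m1 m2 m3 : MeasurableSpace Ω}
    (h1 : m1 ≤ m0) (h2 : m2 ≤ m0) (h3 : m3 ≤ m0)
    (h12 : Indep m1 m2 P) (h123 : Indep m3 (m1 ⊔ m2) P) : Indep m1 (m2 ⊔ m3) P := by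
  refine IndepSets.indep h1 (sup_le h2 h3) (@MeasurableSpace.isPiSystem_measurableSet Ω m1)
    (interPi_isPiSystem m2 m3)
    (@MeasurableSpace.generateFrom_measurableSet Ω m1).symm
    (sup_eq_generateFrom_interPi m2 m3) ?_
  rw [IndepSets_iff]
  rintro A _ hA ⟨C, D, hC, hD, rfl⟩
  rw [Indep_iff] at h12 h123
  have hA' : MeasurableSet[m1 ⊔ m2] A := (le_sup_left : m1 ≤ m1 ⊔ m2) A hA
  have hC' : MeasurableSet[m1 ⊔ m2] C := (le_sup_right : m2 ≤ m1 ⊔ m2) C hC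
  have e1 := h123 D (A ∩ C) hD (MeasurableSet.inter hA' hC')
  have e2 := h123 D C hD hC'
  have e3 := h12 A C hA hC
  rw [← Set.inter_assoc, Set.inter_comm (A ∩ C) D, e1, Set.inter_comm C D, e2, e3]
  ring

lemma setIntegral_inter_of_indep {Ω : Type*} {m0 : MeasurableSpace Ω} {P : Measure Ω}
    [IsProbabilityMeasure P] {D K : MeasurableSpace Ω}
    (hD : D ≤ m0) (hK : K ≤ m0) (hi : Indep D K P) {h : Ω → ℝ}
    (hh : Measurable[D] h) {E F : Set Ω} (hE : MeasurableSet[D] E) (hF : MeasurableSet[K] F) :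
    ∫ x in E ∩ F, h x ∂P = (∫ x in E, h x ∂P) * P.real F := by
  have hX : Measurable[D] (E.indicator h) := Measurable.indicator hh hE
  have hY : Measurable[K] (F.indicator (fun _ => (1 : ℝ))) :=
    Measurable.indicator measurable_const hF
  have hXY : IndepFun (E.indicator h) (F.indicator (fun _ => (1 : ℝ))) P := by
    rw [IndepFun_iff_Indep]
    exact indep_of_indep_of_le hi hX.comap_le hY.comap_le
  have := hXY.integral_mul_eq_mul_integral (hX.mono hD le_rfl).aestronglyMeasurable
    (hY.mono hK le_rfl).aestronglyMeasurable
  rw [integral_indicator (hD _ hE), integral_indicator (hK _ hF)] at this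
  rw [← integral_indicator ((hD _ hE).inter (hK _ hF))]
  simp only [integral_const, smul_eq_mul, mul_one, measureReal_restrict_apply_univ] at this
  rw [← this]
  congr 1
  ext x
  by_cases h1 : x ∈ E <;> by_cases h2 : x ∈ F <;> simp [h1, h2]

lemma core {Ω : Type*} {m0 : MeasurableSpace Ω} {P : Measure Ω}
    [IsProbabilityMeasure P] {G D K : MeasurableSpace Ω}
    (hD : D ≤ m0) (hK : K ≤ m0) (hGD : G ≤ D) (hi : Indep D K P) {B : Set Ω}
    (hB : MeasurableSet[D] B) (hB' : MeasurableSet[G ⊔ K] B) :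
    ∃ C, MeasurableSet[G] C ∧ B =ᵐ[P] C := by
  have hG : G ≤ m0 := hGD.trans hD
  have hGK : G ⊔ K ≤ m0 := sup_le hG hK
  set f : Ω → ℝ := B.indicator (fun _ => (1 : ℝ)) with hf
  set g : Ω → ℝ := P[f | G] with hg
  have fint : Integrable f P := (integrable_const (1 : ℝ)).indicator (hD _ hB)
  have gint : Integrable g P := integrable_condExp
  have gm : Measurable[G] g := stronglyMeasurable_condExp.measurable
  have fm : Measurable[D] f := Measurable.indicator measurable_const hB
  have fm' : Measurable[G ⊔ K] f := Measurable.indicator measurable_const hB'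
  have key : ∀ S, MeasurableSet[G ⊔ K] S → ∫ x in S, f x ∂P = ∫ x in S, g x ∂P := by
    intro S hS
    induction S, hS using MeasurableSpace.induction_on_inter
      (sup_eq_generateFrom_interPi G K) (interPi_isPiSystem G K) with
    | empty => simp
    | basic S hS =>
      obtain ⟨E, F, hE, hF, rfl⟩ := hS
      rw [setIntegral_inter_of_indep hD hK hi fm (hGD _ hE) hF,
        setIntegral_inter_of_indep hD hK hi (gm.mono hGD le_rfl) (hGD _ hE) hF,
        setIntegral_condExp hG fint hE]
    | compl S hS ih =>
      have e1 := integral_add_compl (hGK _ hS) fint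
      have e2 := integral_add_compl (hGK _ hS) gint
      have e3 : ∫ x, g x ∂P = ∫ x, f x ∂P := integral_condExp hG
      linarith
    | iUnion s hd hs ih =>
      rw [integral_iUnion (fun i => hGK _ (hs i)) hd fint.integrableOn,
        integral_iUnion (fun i => hGK _ (hs i)) hd gint.integrableOn]
      simp_rw [ih]
  have hfg : f =ᵐ[P] g := by
    refine ae_eq_of_forall_setIntegral_eq_of_sigmaFinite' hGK
      (fun _ _ _ => fint.integrableOn) (fun _ _ _ => gint.integrableOn)
      (fun s hs _ => key s hs) ?_ ?_
    · exact fm'.stronglyMeasurable.aestronglyMeasurable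
    · exact (gm.mono le_sup_left le_rfl).stronglyMeasurable.aestronglyMeasurable
  refine ⟨g ⁻¹' {1}, gm (measurableSet_singleton 1), ?_⟩
  filter_upwards [hfg] with x hx
  apply propext
  change x ∈ B ↔ g x = 1
  rw [← hx, hf]
  by_cases h : x ∈ B <;> simp [h]

lemma sup_nullSA {Ω : Type*} (G : MeasurableSpace Ω) {m0 : MeasurableSpace Ω} (P : Measure Ω) :
    G ⊔ nullSA P = eventuallyMeasurableSpace G (ae P) := by
  apply le_antisymm
  · refine sup_le le_eventuallyMeasurableSpace (MeasurableSpace.generateFrom_le ?_)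
    intro s hs
    exact ⟨∅, @MeasurableSet.empty _ G, ae_eq_empty.2 hs⟩
  · rintro s ⟨t, ht, hst⟩
    have h := ae_eq_set.1 hst
    have n1 : MeasurableSet[G ⊔ nullSA P] (s \ t) :=
      (le_sup_right : nullSA P ≤ G ⊔ nullSA P) _ (MeasurableSpace.measurableSet_generateFrom h.1)
    have n2 : MeasurableSet[G ⊔ nullSA P] (t \ s) :=
      (le_sup_right : nullSA P ≤ G ⊔ nullSA P) _ (MeasurableSpace.measurableSet_generateFrom h.2)
    have n3 : MeasurableSet[G ⊔ nullSA P] t := (le_sup_left : G ≤ G ⊔ nullSA P) _ ht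
    have : s = (t \ (t \ s)) ∪ (s \ t) := by
      ext x; by_cases h1 : x ∈ s <;> by_cases h2 : x ∈ t <;> simp [h1, h2]
    rw [this]
    exact MeasurableSet.union (MeasurableSet.diff n3 n2) n1

/-- The past of `W` up to `s`. -/
def pastSA {Ω : Type*} (W : ℝ → Ω → ℝ) (s : ℝ) : MeasurableSpace Ω :=
  ⨆ u ∈ Set.Icc (0 : ℝ) s, MeasurableSpace.comap (W u) inferInstance

/-- The σ-algebra of increments after `s`. -/
def incSA {Ω : Type*} (R : ℝ) (W : ℝ → Ω → ℝ) (s : ℝ) : MeasurableSpace Ω :=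
  ⨆ S : Finset (Set.Icc s R), ⨆ t ∈ S,
    MeasurableSpace.comap (fun ω => W (t : ℝ) ω - W s ω) inferInstance

lemma pastSA_meas {Ω : Type*} {W : ℝ → Ω → ℝ} {s u : ℝ} (h0 : 0 ≤ u) (hu : u ≤ s) :
    Measurable[pastSA W s] (W u) :=
  Measurable.of_comap_le (le_iSup₂_of_le u ⟨h0, hu⟩ le_rfl)

lemma incSA_meas {Ω : Type*} {R : ℝ} {W : ℝ → Ω → ℝ} {s t : ℝ} (h0 : s ≤ t) (hu : t ≤ R) :
    Measurable[incSA R W s] (fun ω => W t ω - W s ω) :=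
  Measurable.of_comap_le (le_iSup_of_le {⟨t, h0, hu⟩}
    (le_iSup₂_of_le ⟨t, h0, hu⟩ (Finset.mem_singleton_self _) le_rfl))

lemma incSA_le {Ω : Type*} {R : ℝ} {W : ℝ → Ω → ℝ} {s : ℝ} {m : MeasurableSpace Ω}
    (h : ∀ t, s ≤ t → t ≤ R → Measurable[m] (fun ω => W t ω - W s ω)) :
    incSA R W s ≤ m :=
  iSup_le fun _ => iSup₂_le fun t _ => (h t t.2.1 t.2.2).comap_le

lemma pastSA_mono {Ω : Type*} {W : ℝ → Ω → ℝ} {s t : ℝ} (h : s ≤ t) :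
    pastSA W s ≤ pastSA W t :=
  iSup₂_le fun _ hu => (pastSA_meas hu.1 (hu.2.trans h)).comap_le

lemma indep_past_inc {Ω : Type*} [m0 : MeasurableSpace Ω] {PW : Measure Ω}
    [IsProbabilityMeasure PW] {R : ℝ} {W : ℝ → Ω → ℝ} (hW : IsBrownian PW R W)
    {s : ℝ} (hs : 0 ≤ s) : Indep (incSA R W s) (pastSA W s) PW := by
  have hm : ∀ u, Measurable (W u) := fun u => hW.measurable.comp measurable_prodMk_left
  have hpast : ∀ u, pastSA W u ≤ m0 := fun u => iSup₂_le fun v _ => (hm v).comap_le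
  have hle : ∀ S : Finset (Set.Icc s R), (⨆ t ∈ S,
      MeasurableSpace.comap (fun ω => W (t : ℝ) ω - W s ω) inferInstance) ≤ m0 := fun S =>
    iSup₂_le fun t _ => ((hm t).sub (hm s)).comap_le
  have hii := hW.indep_incr
  have hd : ∀ a b : ℝ,
      MeasurableSpace.comap (fun ω => W a ω - W b ω) inferInstance ≤ m0 := fun a b =>
    ((hm a).sub (hm b)).comap_le
  refine indep_iSup_of_directed_le ?_ hle (hpast s) ?_
  swap
  · refine Monotone.directed_le ?_
    intro S S' h
    exact biSup_mono fun t ht => h ht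
  intro S
  induction S using Finset.induction_on_max with
  | empty => simpa using indep_bot_left _
  | insert a S ha ih =>
    -- the last time before `a`
    obtain ⟨b, hsb, hba, hb⟩ : ∃ b : ℝ, s ≤ b ∧ b ≤ a ∧ (∀ t ∈ S, (t : ℝ) ≤ b) ∧
        Measurable[⨆ t ∈ S, MeasurableSpace.comap (fun ω => W (t : ℝ) ω - W s ω) inferInstance]
          (fun ω => W b ω - W s ω) := by
      rcases S.eq_empty_or_nonempty with rfl | hne
      · refine ⟨s, le_rfl, a.2.1, by simp, ?_⟩
        simp only [sub_self]
        exact measurable_const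
      · refine ⟨S.max' hne, (S.max' hne).2.1, (ha _ (S.max'_mem hne)).le,
          fun t ht => S.le_max' t ht, ?_⟩
        exact Measurable.of_comap_le (le_iSup₂_of_le (S.max' hne) (S.max'_mem hne) le_rfl)
    obtain ⟨hbS, hbm⟩ := hb
    set mS := ⨆ t ∈ S, MeasurableSpace.comap (fun ω => W (t : ℝ) ω - W s ω) inferInstance with hmS
    set m3 := MeasurableSpace.comap (fun ω => W (a : ℝ) ω - W b ω) inferInstance with hm3
    have hsub : pastSA W s ⊔ mS ≤ pastSA W b := by
      refine sup_le (pastSA_mono hsb) (iSup₂_le fun t ht => ?_)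
      exact (Measurable.sub (pastSA_meas (hs.trans t.2.1) (hbS t ht))
        (pastSA_meas hs hsb)).comap_le
    have h3 : Indep m3 (pastSA W s ⊔ mS) PW :=
      indep_of_indep_of_le_right (hii b a (hs.trans hsb) hba a.2.2) hsub
    have := (indep_sup_chain (hpast s) (hle S) (hd a b) ih.symm h3).symm
    refine indep_of_indep_of_le_left this ?_
    refine iSup₂_le fun t ht => ?_
    rcases Finset.mem_insert.1 ht with rfl | ht
    · have e : (fun ω => W (t : ℝ) ω - W s ω)
          = fun ω => (W b ω - W s ω) + (W (t : ℝ) ω - W b ω) := by ext ω; ring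
      rw [e]
      refine Measurable.comap_le (Measurable.add (hbm.mono le_sup_left le_rfl) ?_)
      exact (comap_measurable (fun ω => W (t : ℝ) ω - W b ω)).mono le_sup_right le_rfl
    · exact le_sup_of_le_left (le_iSup₂_of_le t ht le_rfl)

lemma indep_prod_inc (PΛ : Measure ΩΛ) (PW : Measure ΩW)
    [IsProbabilityMeasure PΛ] [IsProbabilityMeasure PW] {R : ℝ} {W : ℝ → ΩW → ℝ}
    (hW : IsBrownian PW R W) {s : ℝ} (hs : 0 ≤ s) :
    Indep (incSA R (liftW W : ℝ → ΩΛ × ΩW → ℝ) s)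
      (pastSA (liftW W) s ⊔ MeasurableSpace.comap (Prod.fst : ΩΛ × ΩW → ΩΛ) mΛ)
      (PΛ.prod PW) := by
  have hm : ∀ u, Measurable (W u) := fun u => hW.measurable.comp measurable_prodMk_left
  have hl : ∀ u, Measurable (liftW W u : ΩΛ × ΩW → ℝ) := fun u => (hm u).comp measurable_snd
  have hi := indep_past_inc hW hs
  have hpast : pastSA W s ≤ mW := iSup₂_le fun v _ => (hm v).comap_le
  have hinc : incSA R W s ≤ mW := incSA_le fun t _ _ => (hm t).sub (hm s)
  have l1 : incSA R (liftW W : ℝ → ΩΛ × ΩW → ℝ) s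
      ≤ MeasurableSpace.comap Prod.snd (incSA R W s) := by
    refine incSA_le fun t h1 h2 => ?_
    have h := incSA_meas (W := W) h1 h2
    have h' := @comap_measurable (ΩΛ × ΩW) ΩW (incSA R W s) Prod.snd
    exact @Measurable.comp _ _ _ (_) (incSA R W s) _ _ _ h h'
  have l2 : pastSA (liftW W : ℝ → ΩΛ × ΩW → ℝ) s
      ≤ MeasurableSpace.comap Prod.snd (pastSA W s) :=
    iSup₂_le fun u hu =>
      (Measurable.comp (pastSA_meas hu.1 hu.2) (comap_measurable Prod.snd)).comap_le
  have k1 : incSA R (liftW W : ℝ → ΩΛ × ΩW → ℝ) s ≤ MeasurableSpace.comap Prod.snd mW :=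
    l1.trans (MeasurableSpace.comap_mono hinc)
  have k2 : pastSA (liftW W : ℝ → ΩΛ × ΩW → ℝ) s ≤ MeasurableSpace.comap Prod.snd mW :=
    l2.trans (MeasurableSpace.comap_mono hpast)
  have hsnd : MeasurableSpace.comap (Prod.snd : ΩΛ × ΩW → ΩW) mW ≤ Prod.instMeasurableSpace :=
    measurable_snd.comap_le
  have hfst : MeasurableSpace.comap (Prod.fst : ΩΛ × ΩW → ΩΛ) mΛ ≤ Prod.instMeasurableSpace :=
    measurable_fst.comap_le
  refine indep_sup_chain (k1.trans hsnd) (k2.trans hsnd) hfst ?_ ?_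
  · refine indep_of_indep_of_le ?_ l1 l2
    rw [Indep_iff] at hi ⊢
    rintro _ _ ⟨A, hA, rfl⟩ ⟨B, hB, rfl⟩
    have mp : MeasurePreserving (Prod.snd : ΩΛ × ΩW → ΩW) (PΛ.prod PW) PW :=
      measurePreserving_snd
    rw [← Set.preimage_inter,
      mp.measure_preimage ((hinc _ hA).inter (hpast _ hB)).nullMeasurableSet,
      mp.measure_preimage (hinc _ hA).nullMeasurableSet,
      mp.measure_preimage (hpast _ hB).nullMeasurableSet]
    exact hi A B hA hB
  · refine indep_of_indep_of_le_right ?_ (sup_le k1 k2)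
    have := indepFun_prod (μ := PΛ) (ν := PW) (X := id) (Y := id) measurable_id measurable_id
    exact this

/-- The σ-algebra generated by the first coordinate. -/
def fstSA (ΩΛ ΩW : Type*) [mΛ : MeasurableSpace ΩΛ] : MeasurableSpace (ΩΛ × ΩW) :=
  MeasurableSpace.comap Prod.fst mΛ

end helpers

/-- The initially enlarged filtration `H_r = F^W_r ∨ F^Λ_T` is right-continuous: for every `r ∈ [0,R)`, `⋂_{s > r} H_s = H_r`. -/
theorem enlarged_filtration_right_continuous
    (T R : ℝ) (hT : 0 < T) (hR : 0 < R)
    (PΛ : Measure ΩΛ) (PW : Measure ΩW)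
    [IsProbabilityMeasure PΛ] [IsProbabilityMeasure PW]
    (hcΛ : PΛ.IsComplete) (hcW : PW.IsComplete)
    (W : ℝ → ΩW → ℝ) (Lam : ℝ → ΩΛ → ℝ)
    (hW : IsBrownian PW R W) (hLam : IsTimeChange T R Lam)
    (P : Measure (ΩΛ × ΩW)) (hP : P = PΛ.prod PW)
    (hFLamT : natSA P (liftLam Lam) T
      = MeasurableSpace.comap (Prod.fst : ΩΛ × ΩW → ΩΛ) mΛ ⊔ nullSA P)
    (hFWR : natSA P (liftW W) R
      = MeasurableSpace.comap (Prod.snd : ΩΛ × ΩW → ΩW) mW ⊔ nullSA P) :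
    ∀ r ∈ Set.Ico (0 : ℝ) R,
      (⨅ s ∈ Set.Ioc r R, Hfilt P W Lam T s) = Hfilt P W Lam T r := by
  intro r hr
  subst hP
  set P := PΛ.prod PW with hPdef
  set X : ℝ → ΩΛ × ΩW → ℝ := liftW W with hX
  have hm : ∀ u, Measurable (W u) := fun u => hW.measurable.comp measurable_prodMk_left
  have hl : ∀ u, Measurable (X u) := fun u => (hm u).comp measurable_snd
  have hfst : MeasurableSpace.comap (Prod.fst : ΩΛ × ΩW → ΩΛ) mΛ ≤ Prod.instMeasurableSpace :=
    measurable_fst.comap_le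
  have hsub : ∀ u v, Measurable (fun ω => X u ω - X v ω) := fun u v => (hl u).sub (hl v)
  have hH : ∀ s, Hfilt P W Lam T s = eventuallyMeasurableSpace (pastSA X s ⊔ fstSA ΩΛ ΩW) (ae P) := by
    intro s
    rw [← sup_nullSA, Hfilt, hFLamT]
    change (pastSA X s ⊔ nullSA P) ⊔ (fstSA ΩΛ ΩW ⊔ nullSA P) = _
    rw [sup_sup_sup_comm, sup_idem]
  have hG : ∀ s, pastSA X s ⊔ fstSA ΩΛ ΩW ≤ Prod.instMeasurableSpace := fun s =>
    sup_le (iSup₂_le fun v _ => (hl v).comap_le) hfst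
  have hGmono : ∀ {s t : ℝ}, s ≤ t → pastSA X s ⊔ fstSA ΩΛ ΩW ≤ pastSA X t ⊔ fstSA ΩΛ ΩW := fun h =>
    sup_le_sup_right (pastSA_mono h) _
  have hEmono : ∀ {m m' : MeasurableSpace (ΩΛ × ΩW)}, m ≤ m' →
      eventuallyMeasurableSpace m (ae P) ≤ eventuallyMeasurableSpace m' (ae P) := by
    rintro m m' h s ⟨t, ht, hst⟩
    exact ⟨t, h t ht, hst⟩
  apply le_antisymm
  swap
  · refine le_iInf₂ fun s hs => ?_
    rw [hH, hH]
    exact hEmono (hGmono hs.1.le)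
  intro A hA
  have hrR : 0 < R - r := sub_pos.2 hr.2
  let s : ℕ → ℝ := fun n => r + (R - r) / ((n : ℝ) + 1)
  have hs1 : ∀ n, r < s n := fun n => by
    have : 0 < (R - r) / ((n : ℝ) + 1) := by positivity
    simp only [s]; linarith
  have hanti : Antitone s := by
    intro n k h
    have : (n : ℝ) ≤ k := by exact_mod_cast h
    simp only [s]
    gcongr
  have hs0 : s 0 = R := by simp [s]
  have hs2 : ∀ n, s n ≤ R := fun n => hs0 ▸ hanti (Nat.zero_le n)
  have hlim : Filter.Tendsto s Filter.atTop (nhds r) := by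
    have h1 : Filter.Tendsto (fun n : ℕ => (R - r) * (1 / ((n : ℝ) + 1))) Filter.atTop
        (nhds ((R - r) * 0)) := tendsto_one_div_add_atTop_nhds_zero_nat.const_mul _
    have h2 := h1.const_add r
    simp only [mul_zero, add_zero] at h2
    refine h2.congr fun n => ?_
    simp only [s]; ring
  have hAn : ∀ n, MeasurableSet[eventuallyMeasurableSpace (pastSA X (s n) ⊔ fstSA ΩΛ ΩW) (ae P)] A := by
    intro n
    rw [← hH]
    have : (⨅ s ∈ Set.Ioc r R, Hfilt P W Lam T s) ≤ Hfilt P W Lam T (s n) :=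
      iInf₂_le (s n) ⟨hs1 n, hs2 n⟩
    exact this A hA
  let D : MeasurableSpace (ΩΛ × ΩW) := Prod.instMeasurableSpace ⊓
    ⨅ n, eventuallyMeasurableSpace (pastSA X (s n) ⊔ fstSA ΩΛ ΩW) (ae P)
  let K : MeasurableSpace (ΩΛ × ΩW) := ⨆ n, incSA R X (s n)
  have hincle : ∀ n, incSA R X (s n) ≤ Prod.instMeasurableSpace := fun n =>
    incSA_le fun t _ _ => hsub t _
  have hD : D ≤ Prod.instMeasurableSpace := inf_le_left
  have hK : K ≤ Prod.instMeasurableSpace := iSup_le hincle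
  have hGD : pastSA X r ⊔ fstSA ΩΛ ΩW ≤ D := by
    refine le_inf (hG r) (le_iInf fun n => ?_)
    exact (hGmono (hs1 n).le).trans le_eventuallyMeasurableSpace
  have hi : Indep D K P := by
    refine (indep_iSup_of_monotone (fun n => ?_) hincle hD ?_).symm
    · have h := indep_prod_inc (ΩΛ := ΩΛ) PΛ PW hW (hr.1.trans (hs1 n).le)
      rw [Indep_iff] at h ⊢
      intro F E hF hE
      have hDn : D ≤ eventuallyMeasurableSpace (pastSA X (s n) ⊔ fstSA ΩΛ ΩW) (ae P) :=
        inf_le_right.trans (iInf_le _ n)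
      obtain ⟨E', hE', hEE⟩ := hDn E hE
      rw [measure_congr hEE,
        measure_congr (Filter.EventuallyEq.inter (Filter.EventuallyEq.refl (ae P) F) hEE)]
      exact h F E' hF hE'
    · intro n k hnk
      refine incSA_le fun t h1 h2 => ?_
      have e : (fun ω => X t ω - X (s n) ω)
          = fun ω => (X t ω - X (s k) ω) - (X (s n) ω - X (s k) ω) := by ext ω; ring
      rw [e]
      exact Measurable.sub (incSA_meas ((hanti hnk).trans h1) h2)
        (incSA_meas (hanti hnk) (hs2 n))
  obtain ⟨B, hB, hAB⟩ := hAn 0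
  have hBD : MeasurableSet[D] B := by
    refine MeasurableSpace.measurableSet_inf.2 ⟨hG _ B hB, ?_⟩
    refine MeasurableSpace.measurableSet_iInf.2 fun n => ?_
    exact EventuallyMeasurableSet.congr (hAn n) hAB.symm
  have hXK : ∀ u, r < u → u ≤ R → Measurable[K] (fun ω => X u ω - X r ω) := by
    intro u hu huR
    have hex : ∃ N, ∀ n, N ≤ n → s n ≤ u := by
      have := hlim.eventually (Iic_mem_nhds hu)
      exact Filter.eventually_atTop.1 this
    obtain ⟨N, hN⟩ := hex
    refine @measurable_of_tendsto_metrizable _ _ K _ _ _ _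
      (fun n ω => X u ω - X (s (n + N)) ω) _ (fun n => ?_) ?_
    · exact (incSA_meas (hN _ (Nat.le_add_left _ _)) huR).mono
        (le_iSup (fun n => incSA R X (s n)) (n + N)) le_rfl
    · rw [tendsto_pi_nhds]
      intro ω
      refine Filter.Tendsto.const_sub _ ?_
      have hc : ContinuousWithinAt (fun v => W v ω.2) (Set.Icc 0 R) r :=
        hW.cont ω.2 r ⟨hr.1, hr.2.le⟩
      have h1 : Filter.Tendsto (fun n => s (n + N)) Filter.atTop (nhdsWithin r (Set.Icc 0 R)) :=
        tendsto_nhdsWithin_iff.2 ⟨hlim.comp (Filter.tendsto_add_atTop_nat N),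
          Filter.Eventually.of_forall fun n => ⟨hr.1.trans (hs1 _).le, hs2 _⟩⟩
      exact Filter.Tendsto.comp hc h1
  have hBGK : MeasurableSet[(pastSA X r ⊔ fstSA ΩΛ ΩW) ⊔ K] B := by
    have hle : pastSA X (s 0) ⊔ fstSA ΩΛ ΩW ≤ (pastSA X r ⊔ fstSA ΩΛ ΩW) ⊔ K := by
      refine sup_le (iSup₂_le fun u hu => ?_) (le_sup_of_le_left le_sup_right)
      rcases le_or_gt u r with hur | hur
      · exact le_sup_of_le_left (le_sup_of_le_left (pastSA_meas hu.1 hur).comap_le)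
      · have e : X u = fun ω => X r ω + (X u ω - X r ω) := by ext ω; ring
        rw [e]
        refine Measurable.comap_le (Measurable.add ?_ ?_)
        · exact (pastSA_meas hr.1 le_rfl).mono (le_sup_of_le_left le_sup_left) le_rfl
        · exact (hXK u hur (hu.2.trans (hs2 0))).mono le_sup_right le_rfl
    exact hle B hB
  obtain ⟨C, hC, hBC⟩ := core hD hK hGD hi hBD hBGK
  rw [hH]
  exact ⟨C, hC, hAB.trans hBC⟩

end
end

section
/- For every t ∈ [0,T], F^M_t ∨ F^Λ_t ⊆ Ĥ_t, and consequently (since Ĥ is right-continuous) F_t ⊆ Ĥ_t. -/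
open MeasureTheory ProbabilityTheory

noncomputable section

variable {ΩΛ ΩW : Type*} [mΛ : MeasurableSpace ΩΛ] [mW : MeasurableSpace ΩW]

lemma isPiSystem_aux {Ω : Type*} (m₁ m₂ : MeasurableSpace Ω) :
    IsPiSystem {S : Set Ω | ∃ B C, MeasurableSet[m₁] B ∧ MeasurableSet[m₂] C ∧ S = B ∩ C} := by
  rintro _ ⟨B, C, hB, hC, rfl⟩ _ ⟨B', C', hB', hC', rfl⟩ _
  refine ⟨B ∩ B', C ∩ C', MeasurableSet.inter hB hB', MeasurableSet.inter hC hC', ?_⟩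
  ext x; simp only [Set.mem_inter_iff]; tauto

lemma sup_eq_generateFrom_aux {Ω : Type*} (m₁ m₂ : MeasurableSpace Ω) :
    m₁ ⊔ m₂ = MeasurableSpace.generateFrom
      {S : Set Ω | ∃ B C, MeasurableSet[m₁] B ∧ MeasurableSet[m₂] C ∧ S = B ∩ C} := by
  apply le_antisymm
  · refine sup_le ?_ ?_
    · intro B hB
      exact MeasurableSpace.measurableSet_generateFrom
        ⟨B, Set.univ, hB, MeasurableSet.univ, by simp⟩
    · intro C hC
      exact MeasurableSpace.measurableSet_generateFrom
        ⟨Set.univ, C, MeasurableSet.univ, hC, by simp⟩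
  · apply MeasurableSpace.generateFrom_le
    rintro _ ⟨B, C, hB, hC, rfl⟩
    exact MeasurableSet.inter ((le_sup_left : m₁ ≤ m₁ ⊔ m₂) _ hB)
      ((le_sup_right : m₂ ≤ m₁ ⊔ m₂) _ hC)

lemma indep_sup_aux {Ω : Type*} {m0 : MeasurableSpace Ω} (P : Measure Ω)
    [IsProbabilityMeasure P] {a b c : MeasurableSpace Ω} (ha : a ≤ m0) (hb : b ≤ m0) (hc : c ≤ m0)
    (h1 : Indep a b P) (h2 : Indep c (a ⊔ b) P) : Indep (a ⊔ c) b P := by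
  refine IndepSets.indep (sup_le ha hc) hb (isPiSystem_aux a c)
    (@MeasurableSpace.isPiSystem_measurableSet _ b) (sup_eq_generateFrom_aux a c)
    (@MeasurableSpace.generateFrom_measurableSet _ b).symm ?_
  rw [IndepSets_iff]
  rw [Indep_iff] at h1 h2
  rintro _ B ⟨A, C, hA, hC, rfl⟩ hB
  have hA' : MeasurableSet[a ⊔ b] A := (le_sup_left : a ≤ a ⊔ b) _ hA
  have hB' : MeasurableSet[a ⊔ b] B := (le_sup_right : b ≤ a ⊔ b) _ hB
  have e1 := h2 C (A ∩ B) hC (MeasurableSet.inter hA' hB')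
  have e2 := h2 C A hC hA'
  have e3 := h1 A B hA hB
  rw [show A ∩ C ∩ B = C ∩ (A ∩ B) by ext; simp only [Set.mem_inter_iff]; tauto, e1, e3,
    Set.inter_comm A C, e2]
  ring

/-- σ-algebra of the increments after `s`. -/
def futSA {Ω : Type*} (X : ℝ → Ω → ℝ) (R s : ℝ) : MeasurableSpace Ω :=
  ⨆ u : Set.Icc s R, MeasurableSpace.comap (fun ω => X u ω - X s ω) inferInstance

lemma fut_meas {Ω : Type*} (X : ℝ → Ω → ℝ) {R s u : ℝ} (hs : s ≤ u) (hu : u ≤ R) :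
    Measurable[futSA X R s] (fun ω => X u ω - X s ω) := by
  rw [measurable_iff_comap_le]
  exact le_iSup (fun u : Set.Icc s R =>
    MeasurableSpace.comap (fun ω => X u ω - X s ω) (inferInstance : MeasurableSpace ℝ)) ⟨u, hs, hu⟩

lemma indep_finset {Ω : Type*} {m0 : MeasurableSpace Ω} (P : Measure Ω)
    [IsProbabilityMeasure P] (R : ℝ) (X : ℝ → Ω → ℝ) (G : ℝ → MeasurableSpace Ω)
    (hGle : ∀ s, G s ≤ m0) (hGmono : Monotone G)
    (hX : ∀ u s, 0 ≤ u → u ≤ s → Measurable[G s] (X u))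
    (hind : ∀ s t, 0 ≤ s → s ≤ t → t ≤ R →
      Indep (MeasurableSpace.comap (fun ω => X t ω - X s ω) inferInstance) (G s) P)
    (S : Finset ℝ) : ∀ s, 0 ≤ s → (∀ u ∈ S, s ≤ u ∧ u ≤ R) →
      Indep (⨆ u ∈ S, MeasurableSpace.comap (fun ω => X u ω - X s ω) inferInstance) (G s) P := by
  induction S using Finset.induction_on_min with
  | empty =>
    intro s hs _
    simpa using indep_bot_left (G s)
  | insert a S hlt ih =>
    intro s hs hS
    have ha := hS a (Finset.mem_insert_self _ _)
    have hXm : ∀ u, 0 ≤ u → Measurable (X u) := fun u hu => (hX u u hu le_rfl).mono (hGle u) le_rfl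
    have ih' := ih a (hs.trans ha.1) (fun u hu => ⟨(hlt u hu).le,
      (hS u (Finset.mem_insert_of_mem hu)).2⟩)
    have hle1 : MeasurableSpace.comap (fun ω => X a ω - X s ω) inferInstance ≤ G a := by
      rw [← measurable_iff_comap_le]
      exact (hX a a (hs.trans ha.1) le_rfl).sub (hX s a hs ha.1)
    have key := indep_sup_aux P (hle1.trans (hGle a)) (hGle s)
      (c := ⨆ u ∈ S, MeasurableSpace.comap (fun ω => X u ω - X a ω) inferInstance)
      (by
        refine iSup₂_le fun u hu => ?_
        rw [← measurable_iff_comap_le]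
        exact (hXm u ((hs.trans ha.1).trans (hlt u hu).le)).sub (hXm a (hs.trans ha.1)))
      (hind s a hs ha.1 ha.2)
      (indep_of_indep_of_le_right ih' (sup_le hle1 (hGmono ha.1)))
    refine indep_of_indep_of_le_left key ?_
    refine iSup₂_le fun u hu => ?_
    rw [← measurable_iff_comap_le]
    rcases Finset.mem_insert.1 hu with rfl | hu
    · exact (comap_measurable _).mono le_sup_left le_rfl
    · have e : (fun ω => X u ω - X s ω) = fun ω => (X u ω - X a ω) + (X a ω - X s ω) := by
        ext; ring
      rw [e]
      refine Measurable.add ?_ ?_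
      · rw [measurable_iff_comap_le]
        exact le_trans (le_iSup₂ (f := fun u (_ : u ∈ S) =>
          MeasurableSpace.comap (fun ω => X u ω - X a ω) (inferInstance : MeasurableSpace ℝ)) u hu)
          le_sup_right
      · exact (comap_measurable _).mono le_sup_left le_rfl

lemma indep_fut {Ω : Type*} {m0 : MeasurableSpace Ω} (P : Measure Ω)
    [IsProbabilityMeasure P] (R : ℝ) (X : ℝ → Ω → ℝ) (G : ℝ → MeasurableSpace Ω)
    (hGle : ∀ s, G s ≤ m0) (hGmono : Monotone G)
    (hX : ∀ u s, 0 ≤ u → u ≤ s → Measurable[G s] (X u))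
    (hind : ∀ s t, 0 ≤ s → s ≤ t → t ≤ R →
      Indep (MeasurableSpace.comap (fun ω => X t ω - X s ω) inferInstance) (G s) P)
    (s : ℝ) (hs : 0 ≤ s) : Indep (futSA X R s) (G s) P := by
  classical
  have hXm : ∀ u, 0 ≤ u → Measurable (X u) := fun u hu => (hX u u hu le_rfl).mono (hGle u) le_rfl
  unfold futSA
  rw [iSup_eq_iSup_finset]
  refine indep_iSup_of_directed_le ?_ ?_ (hGle s) ?_
  · intro S
    have := indep_finset P R X G hGle hGmono hX hind (S.map (Function.Embedding.subtype _)) s hs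
      (by
        intro u hu
        simp only [Finset.mem_map, Function.Embedding.coe_subtype] at hu
        obtain ⟨v, _, rfl⟩ := hu
        exact v.2)
    refine indep_of_indep_of_le_left this ?_
    refine iSup₂_le fun u hu => ?_
    exact le_iSup₂ (f := fun (u : ℝ) (_ : u ∈ S.map (Function.Embedding.subtype _)) =>
      MeasurableSpace.comap (fun ω => X u ω - X s ω) (inferInstance : MeasurableSpace ℝ)) (u : ℝ)
      (Finset.mem_map_of_mem _ hu)
  · intro S
    refine iSup₂_le fun u _ => ?_
    rw [← measurable_iff_comap_le]
    exact (hXm u (hs.trans u.2.1)).sub (hXm s hs)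
  · apply Monotone.directed_le
    intro S S' h
    exact biSup_mono fun u hu => h hu

lemma fut_anti {Ω : Type*} (X : ℝ → Ω → ℝ) {R s s' : ℝ} (h : s ≤ s') (h' : s' ≤ R) :
    futSA X R s' ≤ futSA X R s := by
  refine iSup_le fun u => ?_
  rw [← measurable_iff_comap_le]
  have e : (fun ω => X u ω - X s' ω) = fun ω => (X u ω - X s ω) - (X s' ω - X s ω) := by
    ext; ring
  rw [e]
  exact (fut_meas X (h.trans u.2.1) u.2.2).sub (fut_meas X h h')

lemma setIntegral_indep {Ω : Type*} {m0 : MeasurableSpace Ω} (P : Measure Ω)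
    [IsProbabilityMeasure P] {a b : MeasurableSpace Ω} (ha : a ≤ m0) (hb : b ≤ m0)
    (h : Indep a b P) (f : Ω → ℝ) (hf : StronglyMeasurable[a] f) (hfi : Integrable f P)
    (C : Set Ω) (hC : MeasurableSet[b] C) : ∫ x in C, f x ∂P = P.real C * ∫ x, f x ∂P := by
  rw [← setIntegral_condExp hb hfi hC,
    setIntegral_congr_ae (hb _ hC) ((condExp_indep_eq ha hb hf h).mono fun x hx _ => hx)]
  simp

lemma rc_core {Ω : Type*} {m0 : MeasurableSpace Ω} (P : Measure Ω)
    [IsProbabilityMeasure P] {a g k : MeasurableSpace Ω} (ha : a ≤ m0) (hg : g ≤ a) (hk : k ≤ m0)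
    (h : Indep a k P) (A : Set Ω) (hA : MeasurableSet[a] A) (hA' : MeasurableSet[g ⊔ k] A) :
    ∃ B, MeasurableSet[g] B ∧ A =ᵐ[P] B := by
  have hg0 := hg.trans ha
  set f := P[A.indicator (fun _ => (1 : ℝ)) | g] with hf
  have hAi : Integrable (A.indicator (fun _ => (1 : ℝ))) P :=
    (integrable_const _).indicator (ha _ hA)
  have hfi : Integrable f P := integrable_condExp
  have hfm : StronglyMeasurable[g] f := stronglyMeasurable_condExp
  have hgk : g ⊔ k ≤ m0 := sup_le hg0 hk
  have key : ∀ S, MeasurableSet[g ⊔ k] S →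
      ∫ x in S, f x ∂P = ∫ x in S, A.indicator (fun _ => (1 : ℝ)) x ∂P := by
    intro S hS
    induction S, hS using MeasurableSpace.induction_on_inter
      (sup_eq_generateFrom_aux g k) (isPiSystem_aux g k) with
    | empty => simp
    | basic S hS =>
      obtain ⟨B, C, hB, hC, rfl⟩ := hS
      have hB0 := hg0 _ hB
      have hC0 := hk _ hC
      have aux : ∀ φ : Ω → ℝ, StronglyMeasurable[a] φ → Integrable φ P →
          ∫ x in B ∩ C, φ x ∂P = P.real C * ∫ x in B, φ x ∂P := by
        intro φ hφ hφi
        rw [Set.inter_comm, ← setIntegral_indicator hB0, ← integral_indicator hB0]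
        exact setIntegral_indep P ha hk h _ (hφ.indicator (hg _ hB)) (hφi.indicator hB0) C hC
      rw [aux f (hfm.mono hg) hfi,
        aux _ (stronglyMeasurable_const.indicator hA) hAi, setIntegral_condExp hg0 hAi hB]
    | compl S hS ih =>
      have h1 := integral_add_compl (hgk _ hS) hfi
      have h2 := integral_add_compl (hgk _ hS) hAi
      have h3 : ∫ x, f x ∂P = ∫ x, A.indicator (fun _ => (1 : ℝ)) x ∂P := integral_condExp hg0
      linarith
    | iUnion F hd hm ih =>
      rw [integral_iUnion (fun i => hgk _ (hm i)) hd hfi.integrableOn,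
        integral_iUnion (fun i => hgk _ (hm i)) hd hAi.integrableOn]
      exact tsum_congr ih
  have h1 : f =ᵐ[P] P[A.indicator (fun _ => (1 : ℝ)) | g ⊔ k] :=
    ae_eq_condExp_of_forall_setIntegral_eq hgk hAi (fun _ _ _ => hfi.integrableOn)
      (fun s hs _ => key s hs) (hfm.mono le_sup_left).aestronglyMeasurable
  rw [condExp_of_stronglyMeasurable hgk (stronglyMeasurable_const.indicator hA') hAi] at h1
  refine ⟨f ⁻¹' {1}, hfm.measurable (measurableSet_singleton 1), ?_⟩
  filter_upwards [h1] with x hx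
  apply propext
  change x ∈ A ↔ f x = 1
  rw [hx]
  by_cases hxA : x ∈ A <;> simp [hxA]

lemma rc_abstract {Ω : Type*} {m0 : MeasurableSpace Ω} (P : Measure Ω)
    [IsProbabilityMeasure P] (R : ℝ) (X : ℝ → Ω → ℝ) (G : ℝ → MeasurableSpace Ω)
    (hGle : ∀ s, G s ≤ m0) (hGmono : Monotone G)
    (hX : ∀ u s, 0 ≤ u → u ≤ s → Measurable[G s] (X u))
    (hind : ∀ s t, 0 ≤ s → s ≤ t → t ≤ R →
      Indep (MeasurableSpace.comap (fun ω => X t ω - X s ω) inferInstance) (G s) P)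
    (hc : ∀ ω, ContinuousOn (fun r => X r ω) (Set.Icc 0 R))
    (r : ℝ) (hr : 0 ≤ r) (hrR : r < R)
    (hgen : G R ≤ G r ⊔ futSA X R r)
    (A : Set Ω) (hA : ∀ r', r < r' → r' ≤ R → ∃ B, MeasurableSet[G r'] B ∧ A =ᵐ[P] B) :
    ∃ B, MeasurableSet[G r] B ∧ A =ᵐ[P] B := by
  have hXm : ∀ u, 0 ≤ u → Measurable (X u) := fun u hu => (hX u u hu le_rfl).mono (hGle u) le_rfl
  obtain ⟨AR, hAR, hAAR⟩ := hA R hrR le_rfl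
  obtain ⟨σ, hσ, hσm, hσt⟩ := exists_seq_strictAnti_tendsto' hrR
  let a : MeasurableSpace Ω := m0 ⊓ ⨅ n : ℕ, @eventuallyMeasurableSpace Ω (G (σ n)) (ae P) _
  have hf0 : ∀ s, 0 ≤ s → futSA X R s ≤ m0 := by
    intro s hs
    refine iSup_le fun u => ?_
    rw [← measurable_iff_comap_le]
    exact (hXm u (hs.trans u.2.1)).sub (hXm s hs)
  have hk0 : (⨆ n, futSA X R (σ n)) ≤ m0 := iSup_le fun n => hf0 _ (hr.trans (hσm n).1.le)
  have hga : G r ≤ a := by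
    refine le_inf (hGle r) (le_iInf fun n => ?_)
    exact (hGmono (hσm n).1.le).trans le_eventuallyMeasurableSpace
  have hi : Indep a (⨆ n, futSA X R (σ n)) P := by
    apply Indep.symm
    refine indep_iSup_of_directed_le ?_ (fun n => hf0 _ (hr.trans (hσm n).1.le)) inf_le_left ?_
    · intro n
      have h0 := indep_fut P R X G hGle hGmono hX hind (σ n) (hr.trans (hσm n).1.le)
      rw [Indep_iff] at h0 ⊢
      intro C D hC hD
      have hD' : MeasurableSet[@eventuallyMeasurableSpace Ω (G (σ n)) (ae P) _] D :=
        (inf_le_right.trans (iInf_le _ n) : a ≤ _) _ hD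
      obtain ⟨E, hE, hDE⟩ := hD'
      rw [measure_congr hDE, measure_congr ((Filter.EventuallyEq.refl _ C).inter hDE)]
      exact h0 C E hC hE
    · apply Monotone.directed_le
      intro n m hnm
      exact fut_anti X (hσ.antitone hnm) (hσm n).2.le
  have hkr : futSA X R r ≤ ⨆ n, futSA X R (σ n) := by
    refine iSup_le fun u => ?_
    rw [← measurable_iff_comap_le]
    refine @measurable_of_tendsto_metrizable Ω ℝ (⨆ n, futSA X R (σ n)) _ _ _ _
      (fun n ω => X u ω - X (min (σ n) u) ω) _ ?_ ?_
    · intro n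
      rcases le_total (σ n) u with h | h
      · simp only [min_eq_left h]
        exact (fut_meas X h u.2.2).mono (le_iSup (fun n => futSA X R (σ n)) n) le_rfl
      · simp only [min_eq_right h, sub_self]
        exact measurable_const
    · rw [tendsto_pi_nhds]
      intro ω
      refine Filter.Tendsto.sub tendsto_const_nhds ?_
      have h1 : ContinuousWithinAt (fun r => X r ω) (Set.Icc 0 R) r := hc ω r ⟨hr, hrR.le⟩
      refine h1.tendsto.comp (tendsto_nhdsWithin_iff.2 ⟨?_, Filter.Eventually.of_forall fun n => ?_⟩)
      · have := hσt.min (tendsto_const_nhds (x := (u : ℝ)))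
        rwa [min_eq_left u.2.1] at this
      · exact ⟨le_min (hr.trans (hσm n).1.le) (hr.trans u.2.1), min_le_of_left_le (hσm n).2.le⟩
  have hARa : MeasurableSet[a] AR := by
    have hh : MeasurableSet[m0] AR ∧ MeasurableSet[⨅ n : ℕ,
        @eventuallyMeasurableSpace Ω (G (σ n)) (ae P) _] AR := by
      refine ⟨hGle _ _ hAR, ?_⟩
      rw [MeasurableSpace.measurableSet_iInf]
      intro n
      obtain ⟨B, hB, hAB⟩ := hA (σ n) (hσm n).1 (hσm n).2.le
      exact ⟨B, hB, hAAR.symm.trans hAB⟩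
    exact MeasurableSpace.measurableSet_inf.2 hh
  obtain ⟨B, hB, hAB⟩ := rc_core P inf_le_left hga hk0 hi AR hARa
    ((hgen.trans (sup_le_sup_left hkr _)) _ hAR)
  exact ⟨B, hB, hAAR.trans hAB⟩

/-- The unaugmented enlarged filtration. -/
def GSA (W : ℝ → ΩW → ℝ) (s : ℝ) : MeasurableSpace (ΩΛ × ΩW) :=
  (⨆ u ∈ Set.Icc (0 : ℝ) s, MeasurableSpace.comap (liftW W u) inferInstance) ⊔
    MeasurableSpace.comap (Prod.fst : ΩΛ × ΩW → ΩΛ) mΛ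

lemma GSA_mono (W : ℝ → ΩW → ℝ) : Monotone (GSA (ΩΛ := ΩΛ) W) := by
  intro s s' h
  exact sup_le_sup_right (biSup_mono fun u hu => ⟨hu.1, hu.2.trans h⟩) _

lemma GSA_meas (W : ℝ → ΩW → ℝ) {u s : ℝ} (h0 : 0 ≤ u) (hs : u ≤ s) :
    Measurable[GSA (ΩΛ := ΩΛ) W s] (liftW (ΩΛ := ΩΛ) W u) := by
  rw [measurable_iff_comap_le]
  exact le_trans (le_iSup₂ (f := fun u (_ : u ∈ Set.Icc (0 : ℝ) s) =>
    MeasurableSpace.comap (liftW (ΩΛ := ΩΛ) W u) (inferInstance : MeasurableSpace ℝ)) u ⟨h0, hs⟩)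
    le_sup_left

lemma GSA_fst (W : ℝ → ΩW → ℝ) (s : ℝ) :
    Measurable[GSA (ΩΛ := ΩΛ) W s] (Prod.fst : ΩΛ × ΩW → ΩΛ) := by
  rw [measurable_iff_comap_le]
  exact le_sup_right

lemma GSA_le (W : ℝ → ΩW → ℝ) (hW : ∀ u, Measurable (W u)) (s : ℝ) :
    GSA (ΩΛ := ΩΛ) W s ≤ Prod.instMeasurableSpace := by
  refine sup_le (iSup₂_le fun u _ => ?_) ?_
  · rw [← measurable_iff_comap_le]
    exact (hW u).comp measurable_snd
  · rw [← measurable_iff_comap_le]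
    exact measurable_fst

lemma Hfilt_iff (P : Measure (ΩΛ × ΩW)) (W : ℝ → ΩW → ℝ) (Lam : ℝ → ΩΛ → ℝ) (T : ℝ)
    (hFLamT : natSA P (liftLam Lam) T
      = MeasurableSpace.comap (Prod.fst : ΩΛ × ΩW → ΩΛ) mΛ ⊔ nullSA P) (r : ℝ)
    (A : Set (ΩΛ × ΩW)) :
    MeasurableSet[Hfilt P W Lam T r] A ↔ ∃ B, MeasurableSet[GSA W r] B ∧ A =ᵐ[P] B := by
  have hG : GSA W r ≤ Hfilt P W Lam T r := by
    unfold Hfilt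
    rw [hFLamT]
    exact sup_le (le_sup_left.trans le_sup_left) (le_sup_left.trans le_sup_right)
  have hN : ∀ S : Set (ΩΛ × ΩW), P S = 0 → MeasurableSet[Hfilt P W Lam T r] S := by
    intro S hS
    have : nullSA P ≤ Hfilt P W Lam T r := le_sup_right.trans le_sup_left
    exact this _ (MeasurableSpace.measurableSet_generateFrom hS)
  constructor
  · intro hA
    have h : Hfilt P W Lam T r ≤ @eventuallyMeasurableSpace _ (GSA W r) (ae P) _ := by
      have hnull : nullSA P ≤ @eventuallyMeasurableSpace _ (GSA W r) (ae P) _ := by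
        apply MeasurableSpace.generateFrom_le
        intro S hS
        exact ⟨∅, @MeasurableSet.empty _ (GSA W r), ae_eq_empty.2 hS⟩
      unfold Hfilt
      rw [hFLamT]
      refine sup_le (sup_le ?_ hnull) (sup_le ?_ hnull)
      · exact le_trans le_sup_left (le_eventuallyMeasurableSpace (m := GSA W r))
      · exact le_trans le_sup_right (le_eventuallyMeasurableSpace (m := GSA W r))
    exact h _ hA
  · rintro ⟨B, hB, hAB⟩
    obtain ⟨h1, h2⟩ := ae_eq_set.1 hAB
    have e : A = (B \ (B \ A)) ∪ (A \ B) := by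
      ext x; simp only [Set.mem_union, Set.mem_diff]; tauto
    rw [e]
    exact MeasurableSet.union (MeasurableSet.diff (hG _ hB) (hN _ h2)) (hN _ h1)

lemma Hfilt_rc (R : ℝ) (T : ℝ)
    (PΛ : Measure ΩΛ) (PW : Measure ΩW)
    [IsProbabilityMeasure PΛ] [IsProbabilityMeasure PW]
    (W : ℝ → ΩW → ℝ) (Lam : ℝ → ΩΛ → ℝ)
    (hW : IsBrownian PW R W)
    (P : Measure (ΩΛ × ΩW)) (hP : P = PΛ.prod PW)
    (hFLamT : natSA P (liftLam Lam) T
      = MeasurableSpace.comap (Prod.fst : ΩΛ × ΩW → ΩΛ) mΛ ⊔ nullSA P)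
    (r : ℝ) (hr : 0 ≤ r) (hrR : r < R) (A : Set (ΩΛ × ΩW))
    (hA : ∀ r', r < r' → r' ≤ R → MeasurableSet[Hfilt P W Lam T r'] A) :
    MeasurableSet[Hfilt P W Lam T r] A := by
  have hWm : ∀ u, Measurable (W u) := fun u => hW.measurable.comp measurable_prodMk_left
  have : IsProbabilityMeasure P := by rw [hP]; infer_instance
  simp only [Hfilt_iff P W Lam T hFLamT] at hA ⊢
  refine rc_abstract P R (liftW W) (GSA W) (GSA_le W hWm) (GSA_mono W)
    (fun u s => GSA_meas W) ?_ (fun ω => hW.cont ω.2) r hr hrR ?_ A hA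
  · intro s t hs hst htR
    have hmp : MeasurePreserving (Prod.snd : ΩΛ × ΩW → ΩW) P PW := by
      rw [hP]; exact measurePreserving_snd
    have hwi : Indep
        (MeasurableSpace.comap (fun ω : ΩΛ × ΩW => liftW W t ω - liftW W s ω) inferInstance)
        (⨆ u ∈ Set.Icc (0 : ℝ) s, MeasurableSpace.comap (liftW (ΩΛ := ΩΛ) W u) inferInstance)
        P := by
      have h0 := hW.indep_incr s t hs hst htR
      have e1 : MeasurableSpace.comap (fun ω : ΩΛ × ΩW => liftW W t ω - liftW W s ω)
          (inferInstance : MeasurableSpace ℝ)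
          = (MeasurableSpace.comap (fun ω => W t ω - W s ω) inferInstance).comap Prod.snd := by
        rw [MeasurableSpace.comap_comp]; rfl
      have e2 : (⨆ u ∈ Set.Icc (0 : ℝ) s, MeasurableSpace.comap (liftW (ΩΛ := ΩΛ) W u)
          (inferInstance : MeasurableSpace ℝ))
          = (⨆ u ∈ Set.Icc (0 : ℝ) s, MeasurableSpace.comap (W u) inferInstance).comap
            Prod.snd := by
        simp only [MeasurableSpace.comap_iSup, MeasurableSpace.comap_comp]; rfl
      rw [e1, e2]
      rw [Indep_iff] at h0 ⊢
      rintro _ _ ⟨B, hB, rfl⟩ ⟨C, hC, rfl⟩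
      have hB0 : MeasurableSet B :=
        (measurable_iff_comap_le.1 ((hWm t).sub (hWm s)) : _ ≤ mW) _ hB
      have hC0 : MeasurableSet C :=
        (iSup₂_le fun u _ => measurable_iff_comap_le.1 (hWm u) :
          (⨆ u ∈ Set.Icc (0 : ℝ) s, MeasurableSpace.comap (W u) inferInstance) ≤ mW) _ hC
      rw [← Set.preimage_inter, hmp.measure_preimage hB0.nullMeasurableSet,
        hmp.measure_preimage hC0.nullMeasurableSet,
        hmp.measure_preimage (hB0.inter hC0).nullMeasurableSet]
      exact h0 B C hB hC
    have hprod : Indep (MeasurableSpace.comap (Prod.fst : ΩΛ × ΩW → ΩΛ) mΛ)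
        (MeasurableSpace.comap (Prod.snd : ΩΛ × ΩW → ΩW) mW) P := by
      rw [hP]
      exact indepFun_prod (X := id) (Y := id) measurable_id measurable_id
    have hle1 : (⨆ u ∈ Set.Icc (0 : ℝ) s, MeasurableSpace.comap (liftW (ΩΛ := ΩΛ) W u)
        (inferInstance : MeasurableSpace ℝ)) ≤ MeasurableSpace.comap Prod.snd mW := by
      refine iSup₂_le fun u _ => ?_
      rw [← measurable_iff_comap_le]
      exact (hWm u).comp (comap_measurable _)
    have hle2 : MeasurableSpace.comap (fun ω : ΩΛ × ΩW => liftW W t ω - liftW W s ω)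
          (inferInstance : MeasurableSpace ℝ) ≤ MeasurableSpace.comap Prod.snd mW := by
      rw [← measurable_iff_comap_le]
      exact ((hWm t).comp (comap_measurable _)).sub ((hWm s).comp (comap_measurable _))
    have hsnd : MeasurableSpace.comap (Prod.snd : ΩΛ × ΩW → ΩW) mW ≤ Prod.instMeasurableSpace :=
      measurable_iff_comap_le.1 measurable_snd
    have hfst : MeasurableSpace.comap (Prod.fst : ΩΛ × ΩW → ΩΛ) mΛ ≤ Prod.instMeasurableSpace :=
      measurable_iff_comap_le.1 measurable_fst
    exact (indep_sup_aux P (hle1.trans hsnd) (hle2.trans hsnd) hfst hwi.symm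
      (indep_of_indep_of_le_right hprod (sup_le hle1 hle2))).symm
  · refine sup_le (iSup₂_le fun u hu => ?_) (le_sup_right.trans le_sup_left)
    rw [← measurable_iff_comap_le]
    rcases le_total u r with h | h
    · exact (GSA_meas W hu.1 h).mono le_sup_left le_rfl
    · have e : (liftW W u : ΩΛ × ΩW → ℝ) = fun ω => liftW W r ω + (liftW W u ω - liftW W r ω) := by
        ext; ring
      rw [e]
      exact ((GSA_meas W hr le_rfl).mono le_sup_left le_rfl).add
        ((fut_meas (liftW W) h hu.2).mono le_sup_right le_rfl)

lemma HhatSA_iff (P : Measure (ΩΛ × ΩW)) (W : ℝ → ΩW → ℝ) (Lam : ℝ → ΩΛ → ℝ) (T R t : ℝ)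
    (hL : ∀ r c : ℝ, MeasurableSet[Hfilt P W Lam T r] {ω : ΩΛ × ΩW | Lam t ω.1 ≤ c})
    (A : Set (ΩΛ × ΩW)) (hA : MeasurableSet[HhatSA P W Lam T R t] A) :
    MeasurableSet[Hfilt P W Lam T R] A ∧
      ∀ r ∈ Set.Icc (0 : ℝ) R, MeasurableSet[Hfilt P W Lam T r] (A ∩ {ω | Lam t ω.1 ≤ r}) := by
  induction A, hA using MeasurableSpace.generateFrom_induction with
  | hC A hA _ => exact hA
  | empty =>
    refine ⟨@MeasurableSet.empty _ (_), fun r _ => ?_⟩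
    rw [Set.empty_inter]
    exact @MeasurableSet.empty _ (_)
  | compl A _ ih =>
    refine ⟨MeasurableSet.compl ih.1, fun r hr => ?_⟩
    have e : Aᶜ ∩ {ω | Lam t ω.1 ≤ r} = {ω | Lam t ω.1 ≤ r} \ (A ∩ {ω | Lam t ω.1 ≤ r}) := by
      ext; simp only [Set.mem_inter_iff, Set.mem_compl_iff, Set.mem_diff]; tauto
    rw [e]
    exact MeasurableSet.diff (hL r r) (ih.2 r hr)
  | iUnion F _ ih =>
    refine ⟨MeasurableSet.iUnion fun n => (ih n).1, fun r hr => ?_⟩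
    rw [Set.iUnion_inter]
    exact MeasurableSet.iUnion fun n => (ih n).2 r hr

/-- `W_{Λ_u ∧ r}` is measurable with respect to the enlarged σ-algebra at time `r`. -/
lemma stopped_meas (R : ℝ) (PW : Measure ΩW) (W : ℝ → ΩW → ℝ) (L : ΩΛ → ℝ)
    (hW : IsBrownian PW R W) (hLm : Measurable L) (r : ℝ) (hr : r ∈ Set.Icc 0 R) :
    Measurable[GSA W r] (fun ω : ΩΛ × ΩW => W (Set.projIcc 0 r hr.1 (L ω.1)) ω.2) := by
  let U : ℝ → ΩΛ × ΩW → ℝ := fun v ω => W (Set.projIcc 0 r hr.1 v) ω.2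
  have hU : @Measurable _ _ (@Prod.instMeasurableSpace _ _ _ (GSA W r)) _
      (Function.uncurry U) := by
    refine @measurable_uncurry_of_continuous_of_measurable (ΩΛ × ΩW) ℝ ℝ _ _ _ _ _ _ _ _ _
      (GSA W r) U ?_ ?_
    · intro ω
      refine (hW.cont ω.2).comp_continuous
        (continuous_subtype_val.comp continuous_projIcc) fun v => ?_
      exact ⟨(Set.projIcc 0 r hr.1 v).2.1, (Set.projIcc 0 r hr.1 v).2.2.trans hr.2⟩
    · intro v
      exact GSA_meas W (Set.projIcc 0 r hr.1 v).2.1 (Set.projIcc 0 r hr.1 v).2.2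
  have h2 : @Measurable _ _ (GSA W r) (@Prod.instMeasurableSpace _ _ _ (GSA W r))
      (fun ω : ΩΛ × ΩW => (L ω.1, ω)) :=
    @Measurable.prodMk _ (GSA W r) _ _ _ (GSA W r) _ _ (hLm.comp (GSA_fst W r))
      (@measurable_id _ (GSA W r))
  exact hU.comp h2

lemma part_one
    (T R : ℝ) (hR : 0 < R) (PW : Measure ΩW)
    (W : ℝ → ΩW → ℝ) (Lam : ℝ → ΩΛ → ℝ)
    (hW : IsBrownian PW R W) (hLam : IsTimeChange T R Lam)
    (P : Measure (ΩΛ × ΩW))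
    (hFLamT : natSA P (liftLam Lam) T
      = MeasurableSpace.comap (Prod.fst : ΩΛ × ΩW → ΩΛ) mΛ ⊔ nullSA P)
    (t : ℝ) (ht : t ∈ Set.Icc (0 : ℝ) T) :
    natSA P (tcBM W Lam) t ⊔ natSA P (liftLam Lam) t ≤ HhatSA P W Lam T R t := by
  have hG : ∀ r, GSA W r ≤ Hfilt P W Lam T r := fun r A hA =>
    (Hfilt_iff P W Lam T hFLamT r A).2 ⟨A, hA, Filter.EventuallyEq.rfl⟩
  have hN : ∀ r (S : Set (ΩΛ × ΩW)), P S = 0 → MeasurableSet[Hfilt P W Lam T r] S :=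
    fun r S hS => (Hfilt_iff P W Lam T hFLamT r S).2
      ⟨∅, @MeasurableSet.empty _ (GSA W r), ae_eq_empty.2 hS⟩
  have hLm : ∀ u r, Measurable[GSA W r] (fun ω : ΩΛ × ΩW => Lam u ω.1) :=
    fun u r => (hLam.measurable u).comp (GSA_fst W r)
  have hLs : ∀ u r c, MeasurableSet[GSA W r] {ω : ΩΛ × ΩW | Lam u ω.1 ≤ c} :=
    fun u r c => (hLm u r) measurableSet_Iic
  have hnull : nullSA P ≤ HhatSA P W Lam T R t := by
    apply MeasurableSpace.generateFrom_le
    intro S hS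
    exact MeasurableSpace.measurableSet_generateFrom
      ⟨hN R S hS, fun r _ => hN r _ (measure_mono_null Set.inter_subset_left hS)⟩
  refine sup_le (sup_le (iSup₂_le fun u hu => ?_) hnull) (sup_le (iSup₂_le fun u hu => ?_) hnull)
  · rintro _ ⟨B, hB, rfl⟩
    have hcore : ∀ r ∈ Set.Icc (0 : ℝ) R,
        MeasurableSet[Hfilt P W Lam T r] (tcBM W Lam u ⁻¹' B ∩ {ω | Lam t ω.1 ≤ r}) := by
      intro r hr
      have e : tcBM W Lam u ⁻¹' B ∩ {ω : ΩΛ × ΩW | Lam t ω.1 ≤ r} =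
          (fun ω : ΩΛ × ΩW => W (Set.projIcc 0 r hr.1 (Lam u ω.1)) ω.2) ⁻¹' B ∩
            {ω : ΩΛ × ΩW | Lam t ω.1 ≤ r} := by
        ext ω
        simp only [Set.mem_inter_iff, Set.mem_preimage, Set.mem_setOf_eq, tcBM]
        refine and_congr_left fun h => ?_
        have hu' : u ∈ Set.Icc 0 T := ⟨hu.1, hu.2.trans ht.2⟩
        have h1 : Lam u ω.1 ∈ Set.Icc 0 r :=
          ⟨(hLam.mem ω.1 u hu').1, (hLam.mono ω.1 hu' ht hu.2).trans h⟩
        rw [Set.projIcc_of_mem hr.1 h1]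
      rw [e]
      exact hG r _ (MeasurableSet.inter
        (stopped_meas R PW W (Lam u) hW (hLam.measurable u) r hr hB) (hLs t r r))
    refine MeasurableSpace.measurableSet_generateFrom ⟨?_, hcore⟩
    have := hcore R ⟨hR.le, le_rfl⟩
    rwa [Set.inter_eq_left.2 (fun ω _ => (hLam.mem ω.1 t ht).2)] at this
  · rintro _ ⟨B, hB, rfl⟩
    have h1 : ∀ r, MeasurableSet[GSA W r] (liftLam (ΩW := ΩW) Lam u ⁻¹' B) :=
      fun r => hLm u r hB
    exact MeasurableSpace.measurableSet_generateFrom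
      ⟨hG _ _ (h1 R), fun r _ => hG _ _ (MeasurableSet.inter (h1 r) (hLs t r r))⟩

/-- For every `t ∈ [0,T]`, `F^M_t ∨ F^Λ_t ⊆ Ĥ_t`, and consequently (`Ĥ` being right-continuous) `F_t ⊆ Ĥ_t`. -/
theorem F_le_Hhat
    (T R : ℝ) (hT : 0 < T) (hR : 0 < R)
    (PΛ : Measure ΩΛ) (PW : Measure ΩW)
    [IsProbabilityMeasure PΛ] [IsProbabilityMeasure PW]
    (hcΛ : PΛ.IsComplete) (hcW : PW.IsComplete)
    (W : ℝ → ΩW → ℝ) (Lam : ℝ → ΩΛ → ℝ)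
    (hW : IsBrownian PW R W) (hLam : IsTimeChange T R Lam)
    (P : Measure (ΩΛ × ΩW)) (hP : P = PΛ.prod PW)
    (hFLamT : natSA P (liftLam Lam) T
      = MeasurableSpace.comap (Prod.fst : ΩΛ × ΩW → ΩΛ) mΛ ⊔ nullSA P)
    (hFWR : natSA P (liftW W) R
      = MeasurableSpace.comap (Prod.snd : ΩΛ × ΩW → ΩW) mW ⊔ nullSA P) :
    ∀ t ∈ Set.Icc (0 : ℝ) T,
      natSA P (tcBM W Lam) t ⊔ natSA P (liftLam Lam) t ≤ HhatSA P W Lam T R t ∧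
      Ffilt P W Lam T t ≤ HhatSA P W Lam T R t := by
  have h1 := part_one T R hR PW W Lam hW hLam P hFLamT
  intro t ht
  refine ⟨h1 t ht, ?_⟩
  unfold Ffilt
  split_ifs with htT
  swap
  · have : t = T := le_antisymm ht.2 (not_lt.1 htT)
    subst this
    exact h1 t ht
  have hLs : ∀ u r c, MeasurableSet[Hfilt P W Lam T r] {ω : ΩΛ × ΩW | Lam u ω.1 ≤ c} :=
    fun u r c => (Hfilt_iff P W Lam T hFLamT r _).2 ⟨_,
      ((hLam.measurable u).comp (GSA_fst W r)) measurableSet_Iic, Filter.EventuallyEq.rfl⟩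
  intro A hA
  have hAs : ∀ s ∈ Set.Ioc t T, MeasurableSet[HhatSA P W Lam T R s] A := by
    intro s hs
    exact (h1 s ⟨ht.1.trans hs.1.le, hs.2⟩) _ ((iInf₂_le s hs :
      (⨅ s ∈ Set.Ioc t T, (natSA P (tcBM W Lam) s ⊔ natSA P (liftLam Lam) s)) ≤ _) _ hA)
  have hAp := fun s hs => HhatSA_iff P W Lam T R s (hLs s) A (hAs s hs)
  have hAR : MeasurableSet[Hfilt P W Lam T R] A := (hAp T ⟨htT, le_rfl⟩).1
  refine MeasurableSpace.measurableSet_generateFrom ⟨hAR, fun r hr => ?_⟩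
  rcases hr.2.eq_or_lt with rfl | hrR
  · exact MeasurableSet.inter hAR (hLs t _ _)
  refine Hfilt_rc R T PΛ PW W Lam hW P hP hFLamT r hr.1 hrR _ fun r' hr' hr'R => ?_
  obtain ⟨σ, -, hσm, hσt⟩ := exists_seq_strictAnti_tendsto' htT
  have e : A ∩ {ω : ΩΛ × ΩW | Lam t ω.1 ≤ r} =
      (⋃ n : ℕ, A ∩ {ω : ΩΛ × ΩW | Lam (σ n) ω.1 ≤ r'}) ∩ {ω : ΩΛ × ΩW | Lam t ω.1 ≤ r} := by
    ext ω
    simp only [Set.mem_inter_iff, Set.mem_iUnion, Set.mem_setOf_eq]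
    constructor
    · rintro ⟨hωA, hω⟩
      refine ⟨?_, hω⟩
      have hc := (hLam.right_cont ω.1 t ⟨ht.1, htT⟩).tendsto.comp
        (tendsto_nhdsWithin_iff.2 ⟨hσt, Filter.Eventually.of_forall fun n => (hσm n).1.le⟩)
      obtain ⟨n, hn⟩ := (hc.eventually (Iio_mem_nhds (hω.trans_lt hr'))).exists
      exact ⟨n, hωA, le_of_lt hn⟩
    · rintro ⟨⟨n, hωA, _⟩, hω⟩
      exact ⟨hωA, hω⟩
  rw [e]
  exact MeasurableSet.inter (MeasurableSet.iUnion fun n =>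
    (hAp (σ n) ⟨(hσm n).1, (hσm n).2.le⟩).2 r' ⟨hr.1.trans hr'.le, hr'R⟩) (hLs t _ _)

end
end

section
/- Let Λ be strictly increasing and let θ̃ = (θ̃_r)_{r ∈ [0,R]} be a bounded, jointly measurable process with left-continuous paths such that θ̃_r is F_{Γ_r}-measurable for every r ∈ [0,R]. Then the process A defined by A_t := ∫_0^{Λ_t} θ̃_u du, t ∈ [0,T], is F-adapted (A_t is F_t-measurable for every t) and has càdlàg (right-continuous with left limits) paths. -/
open MeasureTheory

theorem aux_meas {Ω : Type*} [MeasurableSpace Ω] (R : ℝ) (L : Ω → ℝ) (hL : Measurable L)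
    (hLR : ∀ ω, L ω ≤ R) (θ : ℝ → Ω → ℝ)
    (hlc : ∀ ω, ∀ r ∈ Set.Ioc (0 : ℝ) R,
      ContinuousWithinAt (fun s => θ s ω) (Set.Iic r) r)
    (hG : ∀ s ∈ Set.Icc (0 : ℝ) R, Measurable (fun ω => if s < L ω then θ s ω else 0)) :
    Measurable (fun ω => ∫ u in Set.Ioc 0 (L ω), θ u ω) := by
  classical
  let G : ℝ → Ω → ℝ := fun s ω => if s ∈ Set.Icc (0 : ℝ) R then
    (if s < L ω then θ s ω else 0) else 0
  have hGm : ∀ s, Measurable (G s) := by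
    intro s
    by_cases hs : s ∈ Set.Icc (0 : ℝ) R
    · simpa only [G, hs, if_true] using hG s hs
    · simp only [G, hs, if_false]
      exact measurable_const
  let S : Set (ℝ × Ω) := {p | 0 < p.1 ∧ p.1 < L p.2}
  have hS : MeasurableSet S :=
    (measurableSet_lt measurable_const measurable_fst).inter
      (measurableSet_lt measurable_fst (hL.comp measurable_snd))
  let H : ℝ × Ω → ℝ := S.indicator (fun p => θ p.1 p.2)
  let h : ℕ → ℝ × Ω → ℝ := fun n => S.indicator
    (fun p => G ((⌊((n : ℝ) + 1) * p.1⌋ : ℝ) / ((n : ℝ) + 1)) p.2)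
  have hh : ∀ n, Measurable (h n) := by
    intro n
    refine Measurable.indicator ?_ hS
    have h1 : Measurable (fun q : ℤ × Ω => G ((q.1 : ℝ) / ((n : ℝ) + 1)) q.2) :=
      measurable_from_prod_countable_right (fun z => hGm ((z : ℝ) / ((n : ℝ) + 1)))
    have h2 : Measurable (fun p : ℝ × Ω => ((⌊((n : ℝ) + 1) * p.1⌋ : ℤ), p.2)) :=
      (Int.measurable_floor.comp (measurable_fst.const_mul _)).prodMk measurable_snd
    exact h1.comp h2
  have hH : Measurable H := by
    refine measurable_of_tendsto_metrizable hh (tendsto_pi_nhds.2 ?_)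
    rintro ⟨r, ω⟩
    by_cases hp : (r, ω) ∈ S
    · have hr0 : 0 < r := hp.1
      have hrL : r < L ω := hp.2
      have hle : ∀ n : ℕ, (⌊((n : ℝ) + 1) * r⌋ : ℝ) / ((n : ℝ) + 1) ≤ r := by
        intro n
        rw [div_le_iff₀ (by positivity), mul_comm r]
        exact Int.floor_le _
      have hge : ∀ n : ℕ, 0 ≤ (⌊((n : ℝ) + 1) * r⌋ : ℝ) / ((n : ℝ) + 1) := by
        intro n
        have : (0 : ℤ) ≤ ⌊((n : ℝ) + 1) * r⌋ := Int.floor_nonneg.2 (by positivity)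
        have : (0 : ℝ) ≤ (⌊((n : ℝ) + 1) * r⌋ : ℝ) := by exact_mod_cast this
        positivity
      have hlow : ∀ n : ℕ, r - 1 / ((n : ℝ) + 1) ≤
          (⌊((n : ℝ) + 1) * r⌋ : ℝ) / ((n : ℝ) + 1) := by
        intro n
        have hn : (0 : ℝ) < (n : ℝ) + 1 := by positivity
        rw [le_div_iff₀ hn, sub_mul, one_div, inv_mul_cancel₀ hn.ne']
        have := Int.lt_floor_add_one (((n : ℝ) + 1) * r)
        linarith
      have hlim : Filter.Tendsto (fun n : ℕ => (⌊((n : ℝ) + 1) * r⌋ : ℝ) / ((n : ℝ) + 1))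
          Filter.atTop (nhdsWithin r (Set.Iic r)) := by
        refine tendsto_nhdsWithin_iff.2 ⟨?_, Filter.Eventually.of_forall hle⟩
        refine tendsto_of_tendsto_of_tendsto_of_le_of_le ?_ tendsto_const_nhds hlow hle
        simpa using (tendsto_const_nhds (x := r)).sub
          (tendsto_one_div_add_atTop_nhds_zero_nat (𝕜 := ℝ))
      have hc := (hlc ω r ⟨hr0, hrL.le.trans (hLR ω)⟩).tendsto.comp hlim
      have e1 : H (r, ω) = θ r ω := Set.indicator_of_mem hp _
      rw [e1]
      refine hc.congr (fun n => ?_)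
      have e2 : h n (r, ω) = G ((⌊((n : ℝ) + 1) * r⌋ : ℝ) / ((n : ℝ) + 1)) ω :=
        Set.indicator_of_mem hp _
      rw [e2]
      have m1 : (⌊((n : ℝ) + 1) * r⌋ : ℝ) / ((n : ℝ) + 1) ∈ Set.Icc 0 R :=
        ⟨hge n, (hle n).trans (hrL.le.trans (hLR ω))⟩
      have m2 := (hle n).trans_lt hrL
      simp only [G, if_pos m1, if_pos m2, Function.comp]
    · have e1 : H (r, ω) = 0 := Set.indicator_of_notMem hp _
      have e2 : ∀ n, h n (r, ω) = 0 := fun n => Set.indicator_of_notMem hp _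
      simp only [e1, e2]
      exact tendsto_const_nhds
  have hI : Measurable (fun ω => ∫ r, H (r, ω)) :=
    (hH.stronglyMeasurable.integral_prod_left' (μ := volume)).measurable
  convert hI using 2 with ω
  rw [integral_Ioc_eq_integral_Ioo, ← integral_indicator measurableSet_Ioo]
  rfl

theorem aux_cont (f : ℝ → ℝ) (hf : Measurable f) (C : ℝ) (hC : ∀ r, |f r| ≤ C) :
    Continuous (fun x => ∫ u in Set.Ioc 0 x, f u) := by
  have hi : ∀ a b : ℝ, IntervalIntegrable f volume a b := by
    intro a b
    refine (intervalIntegrable_const (c := C)).mono_fun hf.aestronglyMeasurable ?_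
    refine Filter.Eventually.of_forall (fun x => ?_)
    exact (hC x).trans (le_abs_self C)
  have h1 := (intervalIntegral.continuous_primitive hi 0).comp
    (continuous_id.max (continuous_const (y := (0 : ℝ))))
  convert h1 using 2 with x
  simp only [Function.comp, id]
  rw [intervalIntegral.integral_of_le (le_max_right _ _)]
  rcases le_total x 0 with hx | hx
  · rw [max_eq_right hx, Set.Ioc_eq_empty (not_lt.2 hx), Set.Ioc_self]
  · rw [max_eq_left hx]

/-- Let `Λ` be a strictly increasing, right-continuous, `F`-adapted time change and `θ̃` a
bounded jointly measurable process with left-continuous paths such that `θ̃_r` is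
`F_{Γ_r}`-measurable for every `r ∈ [0,R]`, where `Γ` is the generalised inverse of `Λ`.
Then `A_t := ∫_0^{Λ_t} θ̃_u du` is `F`-adapted and has càdlàg paths (right-continuous with
left limits). -/
theorem finiteVariation_part_adapted_cadlag
    {Ω : Type*} [m : MeasurableSpace Ω] (P : Measure Ω) [IsProbabilityMeasure P]
    (T R : ℝ) (hT : 0 < T) (hR : 0 < R)
    (F : ℝ → MeasurableSpace Ω)
    (hle : ∀ t ∈ Set.Icc (0 : ℝ) T, F t ≤ m)
    (hmono : MonotoneOn F (Set.Icc 0 T))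
    (hFrc : ∀ t ∈ Set.Ico (0 : ℝ) T, F t = ⨅ s ∈ Set.Ioc t T, F s)
    (Lam : ℝ → Ω → ℝ)
    (hadapt : ∀ t ∈ Set.Icc (0 : ℝ) T, Measurable[F t] (Lam t))
    (hstrict : ∀ ω, StrictMonoOn (fun t => Lam t ω) (Set.Icc 0 T))
    (hrcLam : ∀ ω, ∀ t ∈ Set.Ico (0 : ℝ) T,
      ContinuousWithinAt (fun s => Lam s ω) (Set.Ici t) t)
    (hLam0 : ∀ ω, Lam 0 ω = 0)
    (hmem : ∀ ω, ∀ t ∈ Set.Icc (0 : ℝ) T, Lam t ω ∈ Set.Icc 0 R)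
    (Γ : ℝ → Ω → ℝ)
    (hΓ : ∀ r ω, Γ r ω =
      if r < Lam T ω then sInf {t ∈ Set.Icc 0 T | r < Lam t ω} else T)
    (θ : ℝ → Ω → ℝ) (C : ℝ) (hbdd : ∀ r ω, |θ r ω| ≤ C)
    (hjm : Measurable (Function.uncurry θ))
    (hlc : ∀ ω, ∀ r ∈ Set.Ioc (0 : ℝ) R,
      ContinuousWithinAt (fun s => θ s ω) (Set.Iic r) r)
    (hθmeas : ∀ r ∈ Set.Icc (0 : ℝ) R,
      Measurable[MeasurableSpace.generateFrom
        {A | MeasurableSet[F T] A ∧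
          ∀ u ∈ Set.Icc (0 : ℝ) T, MeasurableSet[F u] (A ∩ {ω | Γ r ω ≤ u})}] (θ r))
    (A : ℝ → Ω → ℝ)
    (hA : ∀ t ω, A t ω = ∫ u in Set.Ioc 0 (Lam t ω), θ u ω) :
    (∀ t ∈ Set.Icc (0 : ℝ) T, Measurable[F t] (A t)) ∧
    (∀ ω, ∀ t ∈ Set.Ico (0 : ℝ) T,
      ContinuousWithinAt (fun s => A s ω) (Set.Ici t) t) ∧
    (∀ ω, ∀ t ∈ Set.Ioc (0 : ℝ) T, ∃ l : ℝ,
      Filter.Tendsto (fun s => A s ω) (nhdsWithin t (Set.Ico 0 t)) (nhds l)) := by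
  have hΦ : ∀ ω, Continuous (fun x => ∫ u in Set.Ioc 0 x, θ u ω) := fun ω =>
    aux_cont (fun u => θ u ω) (hjm.comp (measurable_id.prodMk measurable_const)) C
      (fun r => hbdd r ω)
  refine ⟨?_, ?_, ?_⟩
  · intro t ht
    have hAt : A t = fun ω => ∫ u in Set.Ioc 0 (Lam t ω), θ u ω := funext (hA t)
    rw [hAt]
    refine @aux_meas Ω (F t) R (Lam t) (hadapt t ht) (fun ω => (hmem ω t ht).2) θ hlc ?_
    intro s hs
    have hLs : MeasurableSet[F t] {ω | s < Lam t ω} := hadapt t ht measurableSet_Ioi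
    have key : ∀ B : Set Ω, MeasurableSet[MeasurableSpace.generateFrom
        {A | MeasurableSet[F T] A ∧
          ∀ u ∈ Set.Icc (0 : ℝ) T, MeasurableSet[F u] (A ∩ {ω | Γ s ω ≤ u})}] B →
        MeasurableSet[F t] (B ∩ {ω | s < Lam t ω}) := by
      intro B hB
      induction B, hB using MeasurableSpace.generateFrom_induction with
      | hC B hB _ =>
        have h1 := @MeasurableSet.inter Ω (F t) _ _ (hB.2 t ht) hLs
        convert h1 using 1
        ext ω
        simp only [Set.mem_inter_iff, Set.mem_setOf_eq]
        refine ⟨fun h => ⟨⟨h.1, ?_⟩, h.2⟩, fun h => ⟨h.1.1, h.2⟩⟩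
        have hT' : s < Lam T ω := h.2.trans_le
          ((hstrict ω).monotoneOn ht ⟨hT.le, le_rfl⟩ ht.2)
        rw [hΓ, if_pos hT']
        exact csInf_le ⟨0, fun x hx => hx.1.1⟩ ⟨ht, h.2⟩
      | empty => simp
      | compl B _ ih =>
        have h1 := @MeasurableSet.diff Ω (F t) _ _ hLs ih
        convert h1 using 1
        ext ω
        simp only [Set.mem_inter_iff, Set.mem_diff, Set.mem_compl_iff]
        tauto
      | iUnion f _ ih =>
        rw [Set.iUnion_inter]
        exact @MeasurableSet.iUnion Ω _ (F t) _ _ ih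
    intro B hB
    have e : (fun ω => if s < Lam t ω then θ s ω else 0) ⁻¹' B =
        (θ s ⁻¹' B ∩ {ω | s < Lam t ω}) ∪ ({ω | s < Lam t ω}ᶜ ∩ {_ω | (0 : ℝ) ∈ B}) := by
      ext ω
      by_cases h : s < Lam t ω <;> simp [h]
    rw [e]
    exact @MeasurableSet.union Ω (F t) _ _ (key _ (hθmeas s hs hB))
      (@MeasurableSet.inter Ω (F t) _ _ (@MeasurableSet.compl Ω _ (F t) hLs)
        (@MeasurableSet.const Ω (F t) _))
  · intro ω t ht
    simp only [hA]
    exact (hΦ ω).continuousAt.comp_continuousWithinAt (hrcLam ω t ht)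
  · intro ω t ht
    have hm : MonotoneOn (fun s => Lam s ω) (Set.Ioo 0 t) :=
      (hstrict ω).monotoneOn.mono (fun x hx => ⟨hx.1.le, hx.2.le.trans ht.2⟩)
    have hb : BddAbove ((fun s => Lam s ω) '' Set.Ioo 0 t) := by
      refine ⟨R, ?_⟩
      rintro _ ⟨x, hx, rfl⟩
      exact (hmem ω x ⟨hx.1.le, hx.2.le.trans ht.2⟩).2
    have hl := hm.tendsto_nhdsWithin_Ioo_left (Set.nonempty_Ioo.2 ht.1) hb
    simp only [hA]
    rw [nhdsWithin_Ico_eq_nhdsLT ht.1]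
    exact ⟨_, ((hΦ ω).tendsto _).comp hl⟩
end
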